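/- arXiv:2409.02717 — 4 statements merged into one kernel-verified Lean document; each statement's English description precedes it below -/
import Mathlib

section
/- For all sufficiently large n there exists α_n ∈ [0, n^{-δ/2}] such that for all x, y ∈ V one has \tilde c_n(x,y) ≤ (1-α_n)·χ_U(x,y)/g(x,y) + α_n, with equality when x = y (where χ_U is the indicator function of U). -/
open Filter Real Topology

/-- `r(z) = ∑_{i ∈ {1,…,k}∖S} z^(k+1-i)`. -/
noncomputable def rIndexed (k : ℕ) (S : Finset ℕ) (z : ℝ) : ℝ :=
  ∑ i ∈ Finset.Icc 1 k \ S, z ^ (k + 1 - i)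

/-- The covariance `c̃_n(x,y)` of the normalized Gaussian random polynomial with the
coefficients indexed by `S` fixed to zero. -/
noncomputable def ctil (k : ℕ) (S : Finset ℕ) (n : ℕ) (x y : ℝ) : ℝ :=
  ((x * y) ^ (n - k - 1) * rIndexed k S (x * y) +
      ∑ i ∈ Finset.Icc 1 (n - k), (x * y) ^ (n - k - i)) /
    Real.sqrt
      ((x ^ (2 * (n - k - 1)) * rIndexed k S (x ^ 2) +
          ∑ i ∈ Finset.Icc 1 (n - k), x ^ (2 * (n - k - i))) *
        (y ^ (2 * (n - k - 1)) * rIndexed k S (y ^ 2) +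
          ∑ i ∈ Finset.Icc 1 (n - k), y ^ (2 * (n - k - i))))

/-- `g(x,y) = |xy-1|/√(|(x²-1)(y²-1)|)`. -/
noncomputable def gcov (x y : ℝ) : ℝ :=
  |x * y - 1| / Real.sqrt (|(x ^ 2 - 1) * (y ^ 2 - 1)|)

/-- `I₁ = [1-n^(-δ), 1-n^(-(1-δ))]`. -/
noncomputable def I1 (δ : ℝ) (n : ℕ) : Set ℝ :=
  Set.Icc (1 - (n : ℝ) ^ (-δ)) (1 - (n : ℝ) ^ (-(1 - δ)))

/-- `I₂ = I₁⁻¹`. -/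
noncomputable def I2 (δ : ℝ) (n : ℕ) : Set ℝ := Inv.inv '' I1 δ n

/-- `I₃ = -I₂`. -/
noncomputable def I3 (δ : ℝ) (n : ℕ) : Set ℝ := -(I2 δ n)

/-- `I₄ = -I₁`. -/
noncomputable def I4 (δ : ℝ) (n : ℕ) : Set ℝ := -(I1 δ n)

/-- `V = I₁ ∪ I₂ ∪ I₃ ∪ I₄`. -/
noncomputable def Vset (δ : ℝ) (n : ℕ) : Set ℝ :=
  I1 δ n ∪ I2 δ n ∪ I3 δ n ∪ I4 δ n

/-- `U = I₁² ∪ I₂² ∪ I₃² ∪ I₄² ⊆ V²`. -/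
noncomputable def Uset (δ : ℝ) (n : ℕ) : Set (ℝ × ℝ) :=
  (I1 δ n ×ˢ I1 δ n) ∪ (I2 δ n ×ˢ I2 δ n) ∪ (I3 δ n ×ˢ I3 δ n) ∪ (I4 δ n ×ˢ I4 δ n)

/-- The sum of the powers `z ^ j` over the exponents `j < n` outside `B`. -/
noncomputable def gapSum (n : ℕ) (B : Finset ℕ) (z : ℝ) : ℝ :=
  ∑ j ∈ Finset.range n \ B, z ^ j

/-- The normalized kernel `(x, y) ↦ gapSum n B (x * y)`. -/
noncomputable def gapCorr (n : ℕ) (B : Finset ℕ) (x y : ℝ) : ℝ :=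
  gapSum n B (x * y) / √(gapSum n B (x ^ 2) * gapSum n B (y ^ 2))

/-- The difference between `1` and `(1 - z) * gapSum n B z`. -/
noncomputable def gapDefect (n : ℕ) (B : Finset ℕ) (z : ℝ) : ℝ :=
  z ^ n + ∑ j ∈ B, (z ^ j - z ^ (j + 1))

/-- The set `B` consists of at most `k` exponents below `n`, each of them less than `k` or at
least `n - k`. -/
structure IsGap (k n : ℕ) (B : Finset ℕ) : Prop where
  card_le : B.card ≤ k
  lt : ∀ j ∈ B, j < n
  extreme : ∀ j ∈ B, j < k ∨ n ≤ j + k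

/-- The quantitative conditions under which `[1 - α ^ 2, b]` is close to `1`, while
`b ^ n` is negligible. -/
structure NearOne (k n : ℕ) (α b : ℝ) : Prop where
  le_n : 2 * k + 2 ≤ n
  α_pos : 0 < α
  α_small : 100 * ((k : ℝ) + 1) ^ 4 * α ^ 2 ≤ 1
  b_pos : 0 < b
  b_lt_one : b < 1
  pow_small : n * b ^ (n - k - 1) ≤ α

lemma gapSum_eq_sub {n : ℕ} {B : Finset ℕ} (hB : ∀ j ∈ B, j < n) (z : ℝ) :
    gapSum n B z = ∑ j ∈ Finset.range n, z ^ j - ∑ j ∈ B, z ^ j := by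
  rw [gapSum, ← Finset.sum_sdiff (s₁ := B) (s₂ := Finset.range n)
    (fun j hj => Finset.mem_range.2 (hB j hj))]
  ring

lemma one_sub_mul_gapSum {n : ℕ} {B : Finset ℕ} (hB : ∀ j ∈ B, j < n) (z : ℝ) :
    (1 - z) * gapSum n B z = 1 - gapDefect n B z := by
  have h := geom_sum_mul z n
  have h2 : (1 - z) * ∑ j ∈ B, z ^ j = ∑ j ∈ B, (z ^ j - z ^ (j + 1)) := by
    rw [Finset.mul_sum]
    exact Finset.sum_congr rfl fun j _ => by ring
  rw [gapSum_eq_sub hB, gapDefect, ← h2]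
  linear_combination -h

lemma gapSum_pos {k n : ℕ} {B : Finset ℕ} (hB : IsGap k n B) (hn : 2 * k + 2 ≤ n) {z : ℝ}
    (hz : 0 < z) : 0 < gapSum n B z := by
  refine Finset.sum_pos (fun j _ => pow_pos hz j) ⟨k, ?_⟩
  refine Finset.mem_sdiff.2 ⟨Finset.mem_range.2 (by omega), fun h => ?_⟩
  rcases hB.extreme k h with h | h <;> omega

lemma gapDefect_nonneg (n : ℕ) (B : Finset ℕ) {z : ℝ} (h0 : 0 ≤ z) (h1 : z ≤ 1) :
    0 ≤ gapDefect n B z := by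
  refine add_nonneg (pow_nonneg h0 n) (Finset.sum_nonneg fun j _ => ?_)
  exact sub_nonneg.2 (pow_le_pow_of_le_one h0 h1 j.le_succ)

lemma gapDefect_le (n : ℕ) (B : Finset ℕ) {z : ℝ} (h0 : 0 ≤ z) (h1 : z ≤ 1) :
    gapDefect n B z ≤ z ^ n + B.card * (1 - z) := by
  have : ∑ j ∈ B, (z ^ j - z ^ (j + 1)) ≤ ∑ j ∈ B, (1 - z) := by
    refine Finset.sum_le_sum fun j _ => ?_
    have := mul_le_mul_of_nonneg_right (pow_le_one₀ (n := j) h0 h1) (sub_nonneg.2 h1)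
    rw [pow_succ]; linarith
  rw [Finset.sum_const, nsmul_eq_mul] at this
  rw [gapDefect]
  linarith

lemma gapDefect_second_difference {n : ℕ} {B : Finset ℕ} {z w K : ℝ}
    (hn : |z ^ n - w ^ n| ≤ K * |z - w|) (hB : ∀ j ∈ B, |z ^ j - w ^ j| ≤ K * |z - w|) :
    gapDefect n B (z ^ 2) + gapDefect n B (w ^ 2) - 2 * gapDefect n B (z * w) ≤
      (B.card + 1) * K ^ 2 * (z - w) ^ 2 := by
  have hsq : ∀ j, |z ^ j - w ^ j| ≤ K * |z - w| → (z ^ j - w ^ j) ^ 2 ≤ K ^ 2 * (z - w) ^ 2 := by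
    intro j hj
    rw [← sq_abs (z ^ j - w ^ j), ← sq_abs (z - w), ← mul_pow]
    exact pow_le_pow_left₀ (abs_nonneg _) hj 2
  have hid : gapDefect n B (z ^ 2) + gapDefect n B (w ^ 2) - 2 * gapDefect n B (z * w) =
      (z ^ n - w ^ n) ^ 2 +
        ∑ j ∈ B, ((z ^ j - w ^ j) ^ 2 - (z ^ (j + 1) - w ^ (j + 1)) ^ 2) := by
    have : ∑ j ∈ B, ((z ^ j - w ^ j) ^ 2 - (z ^ (j + 1) - w ^ (j + 1)) ^ 2) =
        ∑ j ∈ B, ((z ^ 2) ^ j - (z ^ 2) ^ (j + 1)) + ∑ j ∈ B, ((w ^ 2) ^ j - (w ^ 2) ^ (j + 1))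
          - 2 * ∑ j ∈ B, ((z * w) ^ j - (z * w) ^ (j + 1)) := by
      rw [Finset.mul_sum, ← Finset.sum_add_distrib, ← Finset.sum_sub_distrib]
      exact Finset.sum_congr rfl fun j _ => by ring
    rw [this, gapDefect, gapDefect, gapDefect]
    ring
  have hsum : ∑ j ∈ B, ((z ^ j - w ^ j) ^ 2 - (z ^ (j + 1) - w ^ (j + 1)) ^ 2) ≤
      ∑ j ∈ B, K ^ 2 * (z - w) ^ 2 :=
    Finset.sum_le_sum fun j hj => by
      linarith [hsq j (hB j hj), sq_nonneg (z ^ (j + 1) - w ^ (j + 1))]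
  rw [Finset.sum_const, nsmul_eq_mul] at hsum
  rw [hid]
  linarith [hsq n hn]

lemma abs_gapDefect_sub_le {n : ℕ} {B : Finset ℕ} {z w K : ℝ} (hz0 : 0 ≤ z) (hz1 : z ≤ 1)
    (hw0 : 0 ≤ w) (hw1 : w ≤ 1) (hn : |z ^ n - w ^ n| ≤ K * |z - w|)
    (hB : ∀ j ∈ B, |z ^ j - w ^ j| ≤ K * |z - w|)
    (hB' : ∀ j ∈ B, |z ^ (j + 1) - w ^ (j + 1)| ≤ K * |z - w|) :
    |gapDefect n B (z ^ 2) - gapDefect n B (w ^ 2)| ≤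
      (2 * B.card + 1) * (2 * K * |z - w|) := by
  have hsq : ∀ j, |z ^ j - w ^ j| ≤ K * |z - w| →
      |(z ^ 2) ^ j - (w ^ 2) ^ j| ≤ 2 * K * |z - w| := by
    intro j hj
    have h1 : (z ^ 2) ^ j - (w ^ 2) ^ j = (z ^ j - w ^ j) * (z ^ j + w ^ j) := by ring
    have h2 : |z ^ j + w ^ j| ≤ 2 := by
      rw [abs_of_nonneg (by positivity)]
      linarith [pow_le_one₀ (n := j) hz0 hz1, pow_le_one₀ (n := j) hw0 hw1]
    rw [h1, abs_mul]
    calc _ ≤ (K * |z - w|) * 2 :=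
          mul_le_mul hj h2 (abs_nonneg _) ((abs_nonneg _).trans hj)
      _ = _ := by ring
  have hid : gapDefect n B (z ^ 2) - gapDefect n B (w ^ 2) =
      ((z ^ 2) ^ n - (w ^ 2) ^ n) + ∑ j ∈ B, (((z ^ 2) ^ j - (w ^ 2) ^ j) -
        ((z ^ 2) ^ (j + 1) - (w ^ 2) ^ (j + 1))) := by
    have : ∑ j ∈ B, (((z ^ 2) ^ j - (w ^ 2) ^ j) - ((z ^ 2) ^ (j + 1) - (w ^ 2) ^ (j + 1))) =
        ∑ j ∈ B, ((z ^ 2) ^ j - (z ^ 2) ^ (j + 1))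
          - ∑ j ∈ B, ((w ^ 2) ^ j - (w ^ 2) ^ (j + 1)) := by
      rw [← Finset.sum_sub_distrib]
      exact Finset.sum_congr rfl fun j _ => by ring
    rw [this, gapDefect, gapDefect]
    ring
  have hsum : |∑ j ∈ B, (((z ^ 2) ^ j - (w ^ 2) ^ j) - ((z ^ 2) ^ (j + 1) - (w ^ 2) ^ (j + 1)))| ≤
      ∑ j ∈ B, 2 * (2 * K * |z - w|) := by
    refine (Finset.abs_sum_le_sum_abs _ _).trans (Finset.sum_le_sum fun j hj => ?_)
    refine (abs_sub _ _).trans ?_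
    linarith [hsq j (hB j hj), hsq (j + 1) (hB' j hj)]
  rw [Finset.sum_const, nsmul_eq_mul] at hsum
  rw [hid]
  refine (abs_add_le _ _).trans ?_
  linarith [hsq n hn]

namespace NearOne

variable {k n : ℕ} {α b : ℝ} {B : Finset ℕ} {z w : ℝ}

lemma α_lt (h : NearOne k n α b) : 10 * ((k : ℝ) + 1) ^ 2 * α ≤ 1 := by
  have h1 : (10 * ((k : ℝ) + 1) ^ 2 * α) ^ 2 ≤ 1 ^ 2 := by
    have := h.α_small
    nlinarith
  have h2 := h.α_pos
  exact (sq_le_sq₀ (by positivity) zero_le_one).1 h1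

lemma α_le_tenth (h : NearOne k n α b) : α ≤ 1 / 10 := by
  have h1 := h.α_lt
  have h2 := h.α_pos
  have h3 : (1 : ℝ) ≤ ((k : ℝ) + 1) ^ 2 := one_le_pow₀ (by linarith [k.cast_nonneg (α := ℝ)])
  nlinarith

lemma pos_of_mem (h : NearOne k n α b) (hz : z ∈ Set.Icc (1 - α ^ 2) b) : 0 < z := by
  have h1 := h.α_le_tenth
  have h2 := h.α_pos
  nlinarith [hz.1]

lemma lt_one_of_mem (h : NearOne k n α b) (hz : z ∈ Set.Icc (1 - α ^ 2) b) : z < 1 :=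
  hz.2.trans_lt h.b_lt_one

lemma pow_le (h : NearOne k n α b) : b ^ (n - k - 1) ≤ 1 / 10 := by
  have h1 := h.pow_small
  have h2 : (1 : ℝ) ≤ n := by exact_mod_cast (by have := h.le_n; omega : 1 ≤ n)
  have h3 := pow_pos h.b_pos (n - k - 1)
  nlinarith [h.α_le_tenth]

lemma abs_pow_sub_pow_le (h : NearOne k n α b) (hz : z ∈ Set.Icc (1 - α ^ 2) b)
    (hw : w ∈ Set.Icc (1 - α ^ 2) b) {j : ℕ} (hjn : j ≤ n) (hj : j ≤ k ∨ n ≤ j + k) :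
    |z ^ j - w ^ j| ≤ (k + 1) * |z - w| := by
  have hz0 := (h.pos_of_mem hz).le
  have hw0 := (h.pos_of_mem hw).le
  have hk : (0 : ℝ) ≤ k := k.cast_nonneg
  have hM : max |z| |w| ≤ b := by
    rw [abs_of_nonneg hz0, abs_of_nonneg hw0]
    exact max_le hz.2 hw.2
  have hM0 : 0 ≤ max |z| |w| := (abs_nonneg z).trans (le_max_left _ _)
  have hjb : (j : ℝ) * max |z| |w| ^ (j - 1) ≤ k + 1 := by
    have h1 : max |z| |w| ^ (j - 1) ≤ b ^ (j - 1) := pow_le_pow_left₀ hM0 hM _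
    rcases hj with hj | hj
    · have h2 : b ^ (j - 1) ≤ 1 := pow_le_one₀ h.b_pos.le h.b_lt_one.le
      have h3 : (j : ℝ) ≤ k := by exact_mod_cast hj
      have h4 := pow_nonneg hM0 (j - 1)
      nlinarith [j.cast_nonneg (α := ℝ)]
    · have h2 : b ^ (j - 1) ≤ b ^ (n - k - 1) :=
        pow_le_pow_of_le_one h.b_pos.le h.b_lt_one.le (by omega)
      have h3 : (j : ℝ) ≤ n := by exact_mod_cast hjn
      calc (j : ℝ) * max |z| |w| ^ (j - 1) ≤ n * b ^ (n - k - 1) :=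
            mul_le_mul h3 (h1.trans h2) (pow_nonneg hM0 _) n.cast_nonneg
        _ ≤ k + 1 := by linarith [h.pow_small, h.α_le_tenth]
  refine (_root_.abs_pow_sub_pow_le z w j).trans ?_
  rw [mul_assoc, mul_comm]
  exact mul_le_mul_of_nonneg_right hjb (abs_nonneg _)

lemma one_sub_sq_mem (h : NearOne k n α b) (hz : z ∈ Set.Icc (1 - α ^ 2) b) :
    0 < 1 - z ^ 2 ∧ 1 - z ^ 2 ≤ 2 * α ^ 2 := by
  have h0 := h.pos_of_mem hz
  have h1 := h.lt_one_of_mem hz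
  constructor <;> nlinarith [hz.1]

lemma gapDefect_sq_le (h : NearOne k n α b) (hB : IsGap k n B)
    (hz : z ∈ Set.Icc (1 - α ^ 2) b) : gapDefect n B (z ^ 2) ≤ 1 / 2 := by
  have h0 := h.pos_of_mem hz
  have h1 := h.lt_one_of_mem hz
  have h2 := gapDefect_le n B (sq_nonneg z) (pow_le_one₀ h0.le h1.le)
  have h3 : (z ^ 2) ^ n ≤ 1 / 10 := by
    refine le_trans ?_ h.pow_le
    rw [← pow_mul]
    exact (pow_le_pow_left₀ h0.le hz.2 _).trans
      (pow_le_pow_of_le_one h.b_pos.le h.b_lt_one.le (by omega))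
  have h4 : (B.card : ℝ) ≤ k := by exact_mod_cast hB.card_le
  obtain ⟨h5, h6⟩ := h.one_sub_sq_mem hz
  have h7 : (B.card : ℝ) * (1 - z ^ 2) ≤ k * (2 * α ^ 2) :=
    mul_le_mul h4 h6 h5.le k.cast_nonneg
  have h8 : (k : ℝ) * α ^ 2 ≤ 1 / 100 := by
    have hk : (1 : ℝ) ≤ k + 1 := by linarith [k.cast_nonneg (α := ℝ)]
    have h9 : (k : ℝ) ≤ ((k : ℝ) + 1) ^ 4 := by
      linarith [le_self_pow₀ hk (by norm_num : (4 : ℕ) ≠ 0)]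
    nlinarith [h.α_small, mul_le_mul_of_nonneg_right h9 (sq_nonneg α)]
  linarith

lemma gapSum_sq_lower (h : NearOne k n α b) (hB : IsGap k n B)
    (hz : z ∈ Set.Icc (1 - α ^ 2) b) : 1 / (4 * α ^ 2) ≤ gapSum n B (z ^ 2) := by
  have h1 := one_sub_mul_gapSum hB.lt (z ^ 2)
  have h2 := h.gapDefect_sq_le hB hz
  obtain ⟨h3, h4⟩ := h.one_sub_sq_mem hz
  have h5 := gapSum_pos hB h.le_n (pow_pos (h.pos_of_mem hz) 2)
  have := h.α_pos
  rw [div_le_iff₀ (by positivity)]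
  nlinarith

lemma gapDefect_sq_sub_mul_le (h : NearOne k n α b) (hB : IsGap k n B)
    (hz : z ∈ Set.Icc (1 - α ^ 2) b) (hw : w ∈ Set.Icc (1 - α ^ 2) b) :
    (1 - gapDefect n B (z * w)) ^ 2
        - (1 - gapDefect n B (z ^ 2)) * (1 - gapDefect n B (w ^ 2)) ≤
      6 * ((k : ℝ) + 1) ^ 4 * (z - w) ^ 2 := by
  have hz0 := h.pos_of_mem hz
  have hw0 := h.pos_of_mem hw
  have hz1 := h.lt_one_of_mem hz
  have hw1 := h.lt_one_of_mem hw
  have hn : |z ^ n - w ^ n| ≤ ((k : ℝ) + 1) * |z - w| :=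
    h.abs_pow_sub_pow_le hz hw le_rfl (by omega)
  have hj : ∀ j ∈ B, |z ^ j - w ^ j| ≤ ((k : ℝ) + 1) * |z - w| := fun j hj =>
    h.abs_pow_sub_pow_le hz hw (hB.lt j hj).le (by have := hB.extreme j hj; omega)
  have hj' : ∀ j ∈ B, |z ^ (j + 1) - w ^ (j + 1)| ≤ ((k : ℝ) + 1) * |z - w| := fun j hj =>
    h.abs_pow_sub_pow_le hz hw (hB.lt j hj) (by have := hB.extreme j hj; omega)
  have hk : (0 : ℝ) ≤ k := k.cast_nonneg
  have hcard : (B.card : ℝ) ≤ k := by exact_mod_cast hB.card_le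
  have hA := gapDefect_second_difference hn hj
  have hL := abs_gapDefect_sub_le hz0.le hz1.le hw0.le hw1.le hn hj hj'
  have ha := h.gapDefect_sq_le hB hz
  have hb := h.gapDefect_sq_le hB hw
  have ha0 := gapDefect_nonneg n B (sq_nonneg z) (pow_le_one₀ hz0.le hz1.le)
  have hb0 := gapDefect_nonneg n B (sq_nonneg w) (pow_le_one₀ hw0.le hw1.le)
  have hm0 := gapDefect_nonneg n B (mul_pos hz0 hw0).le (mul_le_one₀ hz1.le hw0.le hw1.le)
  have hm1 : gapDefect n B (z * w) ≤ 1 := by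
    have h1 := one_sub_mul_gapSum hB.lt (z * w)
    have h2 := gapSum_pos hB h.le_n (mul_pos hz0 hw0)
    have h3 : 0 ≤ (1 - z * w) * gapSum n B (z * w) :=
      mul_nonneg (sub_nonneg.2 (mul_le_one₀ hz1.le hw0.le hw1.le)) h2.le
    linarith
  generalize gapDefect n B (z ^ 2) = p at *
  generalize gapDefect n B (w ^ 2) = q at *
  generalize gapDefect n B (z * w) = m at *
  set t : ℝ := (k : ℝ) + 1 with ht
  have ht1 : 1 ≤ t := by linarith
  have hsecond : p + q - 2 * m ≤ t ^ 3 * (z - w) ^ 2 := by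
    refine hA.trans (mul_le_mul_of_nonneg_right ?_ (sq_nonneg _))
    calc ((B.card : ℝ) + 1) * t ^ 2 ≤ t * t ^ 2 :=
          mul_le_mul_of_nonneg_right (by linarith) (sq_nonneg _)
      _ = t ^ 3 := by ring
  have hfirst : (p - q) ^ 2 ≤ 16 * t ^ 4 * (z - w) ^ 2 := by
    have h1 : |p - q| ≤ 4 * t ^ 2 * |z - w| := by
      refine hL.trans ?_
      calc (2 * (B.card : ℝ) + 1) * (2 * t * |z - w|) ≤ (2 * t) * (2 * t * |z - w|) :=
            mul_le_mul_of_nonneg_right (by linarith) (by positivity)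
        _ = _ := by ring
    calc (p - q) ^ 2 = |p - q| ^ 2 := (sq_abs _).symm
      _ ≤ (4 * t ^ 2 * |z - w|) ^ 2 := pow_le_pow_left₀ (abs_nonneg _) h1 2
      _ = 16 * t ^ 4 * |z - w| ^ 2 := by ring
      _ = _ := by rw [sq_abs]
  have ht34 : t ^ 3 ≤ t ^ 4 := pow_le_pow_right₀ ht1 (by norm_num)
  have hT : t ^ 3 * (z - w) ^ 2 ≤ t ^ 4 * (z - w) ^ 2 :=
    mul_le_mul_of_nonneg_right ht34 (sq_nonneg _)
  have hT0 : 0 ≤ t ^ 3 * (z - w) ^ 2 := by positivity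
  have hid : (1 - m) ^ 2 - (1 - p) * (1 - q) =
      (p + q - 2 * m) * (1 - (m + (p + q) / 2) / 2) + (p - q) ^ 2 / 4 := by ring
  have hprod : (p + q - 2 * m) * (1 - (m + (p + q) / 2) / 2) ≤ t ^ 3 * (z - w) ^ 2 := by
    calc _ ≤ t ^ 3 * (z - w) ^ 2 * (1 - (m + (p + q) / 2) / 2) :=
          mul_le_mul_of_nonneg_right hsecond (by linarith)
      _ ≤ t ^ 3 * (z - w) ^ 2 * 1 := mul_le_mul_of_nonneg_left (by linarith) hT0
      _ = _ := mul_one _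
  have hT4 : 0 ≤ t ^ 4 * (z - w) ^ 2 := by positivity
  rw [hid]
  linarith

lemma gapCorr_le (h : NearOne k n α b) (hB : IsGap k n B)
    (hz : z ∈ Set.Icc (1 - α ^ 2) b) (hw : w ∈ Set.Icc (1 - α ^ 2) b) :
    gapCorr n B z w ≤ (1 - α) / gcov z w + α := by
  have hz0 := h.pos_of_mem hz
  have hw0 := h.pos_of_mem hw
  have hz1 := h.lt_one_of_mem hz
  have hw1 := h.lt_one_of_mem hw
  have hα := h.α_pos
  have hα1 := h.α_le_tenth
  obtain ⟨hX0, hX⟩ := h.one_sub_sq_mem hz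
  obtain ⟨hY0, hY⟩ := h.one_sub_sq_mem hw
  have hM0 : 0 < 1 - z * w := sub_pos.2 (by nlinarith)
  have hD := h.gapDefect_sq_sub_mul_le hB hz hw
  have hp := h.gapDefect_sq_le hB hz
  have hq := h.gapDefect_sq_le hB hw
  rw [← one_sub_mul_gapSum hB.lt, ← one_sub_mul_gapSum hB.lt, ← one_sub_mul_gapSum hB.lt] at hD
  have hP := one_sub_mul_gapSum hB.lt (z ^ 2)
  have hQ := one_sub_mul_gapSum hB.lt (w ^ 2)
  have hP0 := gapSum_pos hB h.le_n (pow_pos hz0 2)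
  have hQ0 := gapSum_pos hB h.le_n (pow_pos hw0 2)
  have hR0 := gapSum_pos hB h.le_n (mul_pos hz0 hw0)
  have hP2 : 1 / 2 ≤ (1 - z ^ 2) * gapSum n B (z ^ 2) := by linarith
  have hQ2 : 1 / 2 ≤ (1 - w ^ 2) * gapSum n B (w ^ 2) := by linarith
  have hXY0 : 0 < (1 - z ^ 2) * (1 - w ^ 2) := mul_pos hX0 hY0
  have hXY : (1 - z ^ 2) * (1 - w ^ 2) ≤ 4 * α ^ 4 := by
    calc _ ≤ (2 * α ^ 2) * (2 * α ^ 2) := mul_le_mul hX hY hY0.le (by positivity)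
      _ = _ := by ring
  have hMid : (1 - z * w) ^ 2 = (1 - z ^ 2) * (1 - w ^ 2) + (z - w) ^ 2 := by ring
  have hinv : 1 / gcov z w = √((1 - z ^ 2) * (1 - w ^ 2)) / (1 - z * w) := by
    rw [gcov, one_div_div, abs_sub_comm, abs_of_pos hM0]
    congr 2
    rw [abs_of_pos (by linarith)]
    ring
  set u : ℝ := √((1 - z ^ 2) * (1 - w ^ 2)) / (1 - z * w) with hu
  have hu0 : 0 ≤ u := by positivity
  have hu2 : u ^ 2 * (1 - z * w) ^ 2 = (1 - z ^ 2) * (1 - w ^ 2) := by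
    rw [hu, div_pow, Real.sq_sqrt hXY0.le]
    field_simp
  have hu1 : u ≤ 1 := by
    rw [hu, div_le_one hM0]
    refine (Real.sqrt_le_left hM0.le).2 ?_
    rw [hMid]
    linarith [sq_nonneg (z - w)]
  rw [gapCorr]
  generalize gapSum n B (z ^ 2) = p at *
  generalize gapSum n B (w ^ 2) = q at *
  generalize gapSum n B (z * w) = m at *
  have key : ((1 - z * w) * m) ^ 2 * ((1 - z ^ 2) * (1 - w ^ 2)) ≤
      ((1 - z ^ 2) * p * ((1 - w ^ 2) * q)) *
        ((1 - z ^ 2) * (1 - w ^ 2) + α ^ 2 * (z - w) ^ 2) := by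
    have h1 : 1 / 4 ≤ (1 - z ^ 2) * p * ((1 - w ^ 2) * q) := by nlinarith
    have h2 : ((k : ℝ) + 1) ^ 4 * ((1 - z ^ 2) * (1 - w ^ 2)) ≤ α ^ 2 / 25 := by
      calc _ ≤ ((k : ℝ) + 1) ^ 4 * (4 * α ^ 4) :=
            mul_le_mul_of_nonneg_left hXY (by positivity)
        _ = (100 * ((k : ℝ) + 1) ^ 4 * α ^ 2) * (α ^ 2 / 25) := by ring
        _ ≤ 1 * (α ^ 2 / 25) := mul_le_mul_of_nonneg_right h.α_small (by positivity)
        _ = _ := one_mul _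
    have h3 := mul_le_mul_of_nonneg_right hD hXY0.le
    have h4 := mul_le_mul_of_nonneg_right h2 (sq_nonneg (z - w))
    have h5 := mul_le_mul_of_nonneg_right h1 (by positivity : 0 ≤ α ^ 2 * (z - w) ^ 2)
    have h6 : 0 ≤ α ^ 2 * (z - w) ^ 2 := by positivity
    linarith
  have hm2 : m ^ 2 ≤ p * q * (α ^ 2 + (1 - α ^ 2) * u ^ 2) := by
    have h1 : (1 - z * w) ^ 2 * ((1 - z ^ 2) * (1 - w ^ 2)) * m ^ 2 ≤
        (1 - z * w) ^ 2 * ((1 - z ^ 2) * (1 - w ^ 2)) *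
          (p * q * (α ^ 2 + (1 - α ^ 2) * u ^ 2)) := by
      have h2 : (1 - z ^ 2) * (1 - w ^ 2) + α ^ 2 * (z - w) ^ 2 =
          (1 - z * w) ^ 2 * (α ^ 2 + (1 - α ^ 2) * u ^ 2) := by
        linear_combination (-(1 - α ^ 2)) * hu2 - α ^ 2 * hMid
      rw [h2] at key
      linarith
    exact le_of_mul_le_mul_left h1 (by positivity)
  have hsq : α ^ 2 + (1 - α ^ 2) * u ^ 2 ≤ ((1 - α) * u + α) ^ 2 := by
    have : 0 ≤ 2 * α * (1 - α) * (u * (1 - u)) :=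
      mul_nonneg (mul_nonneg (by linarith) (by linarith)) (mul_nonneg hu0 (by linarith))
    nlinarith
  have hrhs : 0 ≤ (1 - α) * u + α := add_nonneg (mul_nonneg (by linarith) hu0) hα.le
  rw [div_eq_mul_one_div (1 - α), hinv, div_le_iff₀ (Real.sqrt_pos.2 (mul_pos hP0 hQ0))]
  refine abs_le_of_sq_le_sq' ?_ (mul_nonneg hrhs (Real.sqrt_nonneg _)) |>.2
  rw [mul_pow, Real.sq_sqrt (mul_pos hP0 hQ0).le, mul_comm (_ ^ 2)]
  exact hm2.trans (mul_le_mul_of_nonneg_left hsq (mul_pos hP0 hQ0).le)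

lemma le_sqrt_gapSum_mul {B' : Finset ℕ} (h : NearOne k n α b) (hB : IsGap k n B)
    (hB' : IsGap k n B') (hz : z ∈ Set.Icc (1 - α ^ 2) b) (hw : w ∈ Set.Icc (1 - α ^ 2) b) :
    1 / (4 * α ^ 2) ≤ √(gapSum n B (z ^ 2) * gapSum n B' (w ^ 2)) := by
  have hα := h.α_pos
  refine Real.le_sqrt_of_sq_le ?_
  rw [sq]
  have h1 := h.gapSum_sq_lower hB hz
  exact mul_le_mul h1 (h.gapSum_sq_lower hB' hw) (by positivity)
    ((by positivity : (0 : ℝ) ≤ _).trans h1)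

lemma abs_gapCorr_neg_le (h : NearOne k n α b) (hB : IsGap k n B)
    (hz : z ∈ Set.Icc (1 - α ^ 2) b) (hw : w ∈ Set.Icc (1 - α ^ 2) b) :
    |gapCorr n B z (-w)| ≤ α := by
  have hz0 := h.pos_of_mem hz
  have hw0 := h.pos_of_mem hw
  have hz1 := h.lt_one_of_mem hz
  have hw1 := h.lt_one_of_mem hw
  have hα := h.α_pos
  have hs := h.le_sqrt_gapSum_mul hB hB hz hw
  have hv0 : 0 < z * w := mul_pos hz0 hw0
  have hv1 : z * w ≤ 1 := mul_le_one₀ hz1.le hw0.le hw1.le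
  have hnum : |gapSum n B (z * -w)| ≤ k + 2 := by
    have hpow : ∀ j : ℕ, |(z * -w) ^ j| ≤ 1 := fun j => by
      rw [abs_pow, mul_neg, abs_neg, abs_of_pos hv0]
      exact pow_le_one₀ hv0.le hv1
    have h1 : |∑ j ∈ Finset.range n, (z * -w) ^ j| ≤ 2 := by
      have h2 := congrArg abs (geom_sum_mul (z * -w) n)
      rw [abs_mul, abs_sub_comm (z * -w) 1, abs_of_pos (by linarith : 0 < 1 - z * -w)] at h2
      have h3 : |(z * -w) ^ n - 1| ≤ 2 := by
        have := abs_le.1 (hpow n)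
        rw [abs_le]; constructor <;> linarith
      nlinarith [abs_nonneg (∑ j ∈ Finset.range n, (z * -w) ^ j)]
    have h4 : |∑ j ∈ B, (z * -w) ^ j| ≤ k := by
      calc _ ≤ ∑ j ∈ B, |(z * -w) ^ j| := Finset.abs_sum_le_sum_abs _ _
        _ ≤ ∑ j ∈ B, (1 : ℝ) := Finset.sum_le_sum fun j _ => hpow j
        _ = B.card := by simp
        _ ≤ k := by exact_mod_cast hB.card_le
    rw [gapSum_eq_sub hB.lt]
    exact (abs_sub _ _).trans (by linarith)
  have hs0 : 0 < 1 / (4 * α ^ 2) := by positivity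
  rw [gapCorr, abs_div, neg_sq, abs_of_pos (hs0.trans_le hs), div_le_iff₀ (hs0.trans_le hs)]
  refine hnum.trans (le_trans ?_ (mul_le_mul_of_nonneg_left hs hα.le))
  have h5 : α * (1 / (4 * α ^ 2)) = 1 / (4 * α) := by field_simp
  rw [h5, le_div_iff₀ (by positivity)]
  have hk : (0 : ℝ) ≤ k := k.cast_nonneg
  have := h.α_lt
  nlinarith [mul_nonneg hk hα.le, mul_nonneg (mul_nonneg hk hk) hα.le]

end NearOne

lemma IsGap.reflect {k n : ℕ} {B : Finset ℕ} (hB : IsGap k n B) :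
    IsGap k n (B.image fun j => n - 1 - j) where
  card_le := Finset.card_image_le.trans hB.card_le
  lt j hj := by
    obtain ⟨i, hi, rfl⟩ := Finset.mem_image.1 hj
    have := hB.lt i hi
    omega
  extreme j hj := by
    obtain ⟨i, hi, rfl⟩ := Finset.mem_image.1 hj
    have := hB.lt i hi
    have := hB.extreme i hi
    omega

lemma gapSum_inv {n : ℕ} {B : Finset ℕ} (hB : ∀ j ∈ B, j < n) {z : ℝ} (hz : z ≠ 0) :
    gapSum n B z⁻¹ = gapSum n (B.image fun j => n - 1 - j) z / z ^ (n - 1) := by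
  rw [gapSum, gapSum, Finset.sum_div]
  refine Finset.sum_nbij' (fun j => n - 1 - j) (fun j => n - 1 - j) ?_ ?_ ?_ ?_ ?_
  · intro j hj
    simp only [Finset.mem_sdiff, Finset.mem_range, Finset.mem_image, not_exists, not_and] at hj ⊢
    refine ⟨by omega, fun i hi hij => hj.2 ?_⟩
    have := hB i hi
    rwa [show j = i by omega]
  · intro j hj
    simp only [Finset.mem_sdiff, Finset.mem_range, Finset.mem_image, not_exists, not_and] at hj ⊢
    exact ⟨by omega, fun h => hj.2 _ h (by omega)⟩
  · intro j hj
    simp only [Finset.mem_sdiff, Finset.mem_range] at hj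
    omega
  · intro j hj
    simp only [Finset.mem_sdiff, Finset.mem_range] at hj
    omega
  · intro j hj
    simp only [Finset.mem_sdiff, Finset.mem_range] at hj
    rw [eq_div_iff (pow_ne_zero _ hz), inv_pow, ← pow_sub_mul_pow z (by omega : j ≤ n - 1)]
    field_simp

lemma gapCorr_comm (n : ℕ) (B : Finset ℕ) (x y : ℝ) : gapCorr n B x y = gapCorr n B y x := by
  rw [gapCorr, gapCorr, mul_comm x y, mul_comm (gapSum n B (x ^ 2))]

lemma gapCorr_neg_neg (n : ℕ) (B : Finset ℕ) (x y : ℝ) :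
    gapCorr n B (-x) (-y) = gapCorr n B x y := by
  simp only [gapCorr, neg_sq, neg_mul_neg]

lemma gapCorr_neg_left (n : ℕ) (B : Finset ℕ) (x y : ℝ) :
    gapCorr n B (-x) y = gapCorr n B x (-y) := by
  rw [← gapCorr_neg_neg, neg_neg]

lemma gapCorr_self {k n : ℕ} {B : Finset ℕ} (hB : IsGap k n B) (hn : 2 * k + 2 ≤ n) {x : ℝ}
    (hx : x ≠ 0) : gapCorr n B x x = 1 := by
  have h := gapSum_pos hB hn (pow_pos (abs_pos.2 hx) 2)
  rw [sq_abs] at h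
  rw [gapCorr, Real.sqrt_mul_self h.le, ← sq, div_self h.ne']

lemma gapCorr_inv_inv {n : ℕ} {B : Finset ℕ} (hB : ∀ j ∈ B, j < n) {x y : ℝ} (hx : x ≠ 0)
    (hy : y ≠ 0) :
    gapCorr n B x⁻¹ y⁻¹ = gapCorr n (B.image fun j => n - 1 - j) x y *
      (|(x * y) ^ (n - 1)| / (x * y) ^ (n - 1)) := by
  have h : (x * y) ^ (n - 1) ≠ 0 := pow_ne_zero _ (mul_ne_zero hx hy)
  rw [gapCorr, gapCorr, ← mul_inv, inv_pow, inv_pow, gapSum_inv hB (mul_ne_zero hx hy),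
    gapSum_inv hB (pow_ne_zero 2 hx), gapSum_inv hB (pow_ne_zero 2 hy), div_mul_div_comm,
    show (x ^ 2) ^ (n - 1) * (y ^ 2) ^ (n - 1) = ((x * y) ^ (n - 1)) ^ 2 by ring,
    Real.sqrt_div' _ (sq_nonneg _), Real.sqrt_sq_eq_abs, div_div_div_eq, div_mul_div_comm]
  congr 1
  ring

lemma abs_gapCorr_inv_inv {n : ℕ} {B : Finset ℕ} (hB : ∀ j ∈ B, j < n) {x y : ℝ} (hx : x ≠ 0)
    (hy : y ≠ 0) :
    |gapCorr n B x⁻¹ y⁻¹| = |gapCorr n (B.image fun j => n - 1 - j) x y| := by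
  have h : |(x * y) ^ (n - 1)| ≠ 0 := abs_ne_zero.2 (pow_ne_zero _ (mul_ne_zero hx hy))
  rw [gapCorr_inv_inv hB hx hy, abs_mul, abs_div, abs_abs, div_self h, mul_one]

lemma gapCorr_inv_inv_of_pos {n : ℕ} {B : Finset ℕ} (hB : ∀ j ∈ B, j < n) {x y : ℝ} (hx : 0 < x)
    (hy : 0 < y) :
    gapCorr n B x⁻¹ y⁻¹ = gapCorr n (B.image fun j => n - 1 - j) x y := by
  have h : 0 < (x * y) ^ (n - 1) := pow_pos (mul_pos hx hy) _
  rw [gapCorr_inv_inv hB hx.ne' hy.ne', abs_of_pos h, div_self h.ne', mul_one]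

lemma gcov_neg_neg (x y : ℝ) : gcov (-x) (-y) = gcov x y := by
  simp only [gcov, neg_sq, neg_mul_neg]

lemma gcov_inv_inv {x y : ℝ} (hx : x ≠ 0) (hy : y ≠ 0) : gcov x⁻¹ y⁻¹ = gcov x y := by
  have h : |x * y| ≠ 0 := abs_ne_zero.2 (mul_ne_zero hx hy)
  have h1 : x⁻¹ * y⁻¹ - 1 = -(x * y - 1) / (x * y) := by field_simp; ring
  have h2 : (x⁻¹ ^ 2 - 1) * (y⁻¹ ^ 2 - 1) = (x ^ 2 - 1) * (y ^ 2 - 1) / (x * y) ^ 2 := by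
    field_simp; ring
  rw [gcov, gcov, h1, h2, abs_div, abs_div, abs_neg, abs_of_nonneg (sq_nonneg (x * y)),
    Real.sqrt_div' _ (sq_nonneg _), Real.sqrt_sq_eq_abs, div_div_div_cancel_right₀ h]

lemma gcov_self {x : ℝ} (hx : x ^ 2 ≠ 1) : gcov x x = 1 := by
  have h : |x ^ 2 - 1| ≠ 0 := abs_ne_zero.2 (sub_ne_zero.2 hx)
  rw [gcov, abs_mul, Real.sqrt_mul_self (abs_nonneg _), ← sq, div_self h]

lemma gcov_nonneg (x y : ℝ) : 0 ≤ gcov x y :=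
  div_nonneg (abs_nonneg _) (Real.sqrt_nonneg _)

lemma NearOne.abs_gapCorr_inv_le {k n : ℕ} {α b z w : ℝ} {B : Finset ℕ} (h : NearOne k n α b)
    (hB : IsGap k n B) (hz : z ∈ Set.Icc (1 - α ^ 2) b) (hw : |w| ∈ Set.Icc (1 - α ^ 2) b) :
    |gapCorr n B z w⁻¹| ≤ α := by
  have hz0 := h.pos_of_mem hz
  have hw0 := h.pos_of_mem hw
  have hα := h.α_pos
  have hs := h.le_sqrt_gapSum_mul hB hB.reflect hz hw
  rw [sq_abs] at hs
  have hs1 : 1 ≤ √(gapSum n B (z ^ 2) * gapSum n (B.image fun j => n - 1 - j) (w ^ 2)) := by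
    refine le_trans ?_ hs
    rw [le_div_iff₀ (by positivity)]
    nlinarith [h.α_le_tenth]
  have hnum : |gapSum n B (z * w⁻¹)| * |w| ^ (n - 1) ≤ α := by
    rw [← abs_pow, ← abs_mul, gapSum, Finset.sum_mul]
    calc _ ≤ ∑ j ∈ Finset.range n \ B, |(z * w⁻¹) ^ j * w ^ (n - 1)| :=
          Finset.abs_sum_le_sum_abs _ _
      _ ≤ ∑ j ∈ Finset.range n \ B, b ^ (n - 1) := by
          refine Finset.sum_le_sum fun j hj => ?_
          have hj' : j ≤ n - 1 := by
            have := Finset.mem_range.1 (Finset.mem_sdiff.1 hj).1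
            omega
          have h1 : (z * w⁻¹) ^ j * w ^ (n - 1) = z ^ j * w ^ (n - 1 - j) := by
            have hwne : w ≠ 0 := abs_pos.1 hw0
            rw [← pow_sub_mul_pow w hj', mul_pow, inv_pow]
            field_simp
          rw [h1, abs_mul, abs_pow, abs_pow, abs_of_pos hz0]
          calc z ^ j * |w| ^ (n - 1 - j) ≤ b ^ j * b ^ (n - 1 - j) :=
                mul_le_mul (pow_le_pow_left₀ hz0.le hz.2 _) (pow_le_pow_left₀ hw0.le hw.2 _)
                  (by positivity) (pow_nonneg h.b_pos.le _)
            _ = b ^ (n - 1) := by rw [← pow_add, Nat.add_sub_cancel' hj']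
      _ = ((Finset.range n \ B).card : ℝ) * b ^ (n - 1) := by
          rw [Finset.sum_const, nsmul_eq_mul]
      _ ≤ n * b ^ (n - k - 1) := by
          refine mul_le_mul ?_ ?_ (pow_nonneg h.b_pos.le _) n.cast_nonneg
          · exact_mod_cast (Finset.card_le_card Finset.sdiff_subset).trans
              (Finset.card_range n).le
          · exact pow_le_pow_of_le_one h.b_pos.le h.b_lt_one.le (by omega)
      _ ≤ α := h.pow_small
  have hden : √(gapSum n B (z ^ 2) * gapSum n B (w⁻¹ ^ 2)) =
      √(gapSum n B (z ^ 2) * gapSum n (B.image fun j => n - 1 - j) (w ^ 2)) / |w| ^ (n - 1) := by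
    rw [inv_pow, gapSum_inv hB.lt (pow_ne_zero 2 (abs_pos.1 hw0)), ← mul_div_assoc,
      ← pow_mul, mul_comm 2, pow_mul, Real.sqrt_div' _ (sq_nonneg _), Real.sqrt_sq_eq_abs, abs_pow]
  rw [gapCorr, hden, abs_div, abs_of_nonneg (div_nonneg (Real.sqrt_nonneg _) (by positivity)),
    div_div_eq_mul_div]
  exact (div_le_self (by positivity) hs1).trans hnum

lemma isGap_image_sub {k n : ℕ} {S : Finset ℕ} (hS : S ⊆ Finset.Icc 1 k) (hn : k < n) :
    IsGap k n (S.image fun i => n - i) where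
  card_le := by
    refine Finset.card_image_le.trans ((Finset.card_le_card hS).trans ?_)
    simp
  lt j hj := by
    obtain ⟨i, hi, rfl⟩ := Finset.mem_image.1 hj
    have := Finset.mem_Icc.1 (hS hi)
    omega
  extreme j hj := by
    obtain ⟨i, hi, rfl⟩ := Finset.mem_image.1 hj
    have := Finset.mem_Icc.1 (hS hi)
    omega

lemma pow_mul_rIndexed_add_sum {k n : ℕ} {S : Finset ℕ} (hS : S ⊆ Finset.Icc 1 k) (hn : k < n)
    (z : ℝ) :
    z ^ (n - k - 1) * rIndexed k S z + ∑ i ∈ Finset.Icc 1 (n - k), z ^ (n - k - i) =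
      gapSum n (S.image fun i => n - i) z := by
  have h1 : z ^ (n - k - 1) * rIndexed k S z = ∑ i ∈ Finset.Icc 1 k \ S, z ^ (n - i) := by
    rw [rIndexed, Finset.mul_sum]
    refine Finset.sum_congr rfl fun i hi => ?_
    have := Finset.mem_Icc.1 (Finset.mem_sdiff.1 hi).1
    rw [← pow_add]
    congr 1
    omega
  have h2 : ∑ i ∈ Finset.Icc 1 (n - k), z ^ (n - k - i) =
      ∑ i ∈ Finset.Icc (k + 1) n, z ^ (n - i) := by
    refine Finset.sum_nbij' (fun i => k + i) (fun i => i - k) ?_ ?_ ?_ ?_ ?_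
    · intro i hi; simp only [Finset.mem_Icc] at *; omega
    · intro i hi; simp only [Finset.mem_Icc] at *; omega
    · intro i hi; simp only [Finset.mem_Icc] at *; omega
    · intro i hi; simp only [Finset.mem_Icc] at *; omega
    · intro i _; rw [Nat.sub_sub]
  have hdisj : Disjoint (Finset.Icc 1 k \ S) (Finset.Icc (k + 1) n) := by
    refine Finset.disjoint_left.2 fun i hi hi' => ?_
    simp only [Finset.mem_sdiff, Finset.mem_Icc] at hi hi'
    omega
  rw [h1, h2, ← Finset.sum_union hdisj, gapSum]
  refine Finset.sum_nbij' (fun i => n - i) (fun j => n - j) ?_ ?_ ?_ ?_ ?_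
  · intro i hi
    simp only [Finset.mem_sdiff, Finset.mem_union, Finset.mem_Icc, Finset.mem_range,
      Finset.mem_image, not_exists, not_and] at hi ⊢
    refine ⟨by omega, fun j hj hij => ?_⟩
    have hjk := Finset.mem_Icc.1 (hS hj)
    obtain rfl : j = i := by omega
    rcases hi with hi | hi
    · exact hi.2 hj
    · omega
  · intro j hj
    simp only [Finset.mem_sdiff, Finset.mem_union, Finset.mem_Icc, Finset.mem_range,
      Finset.mem_image, not_exists, not_and] at hj ⊢
    by_cases hjk : n - j ≤ k
    · exact Or.inl ⟨by omega, fun h => hj.2 _ h (by omega)⟩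
    · exact Or.inr (by omega)
  · intro i hi
    simp only [Finset.mem_sdiff, Finset.mem_union, Finset.mem_Icc] at hi
    omega
  · intro j hj
    simp only [Finset.mem_sdiff, Finset.mem_range] at hj
    omega
  · intro i _; rfl

lemma ctil_eq_gapCorr {k n : ℕ} {S : Finset ℕ} (hS : S ⊆ Finset.Icc 1 k) (hn : k < n)
    (x y : ℝ) : ctil k S n x y = gapCorr n (S.image fun i => n - i) x y := by
  simp only [ctil, gapCorr, ← pow_mul_rIndexed_add_sum hS hn, pow_mul]

lemma eventually_natCast_mul_pow_le_rpow {δ : ℝ} (hδ0 : 0 < δ) (k : ℕ) :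
    ∀ᶠ n : ℕ in atTop, 0 < 1 - (n : ℝ) ^ (-(1 - δ)) →
      n * (1 - (n : ℝ) ^ (-(1 - δ))) ^ (n - k - 1) ≤ (n : ℝ) ^ (-(δ / 2)) := by
  have hlim := ((tendsto_rpow_mul_exp_neg_mul_atTop_nhds_zero ((1 + δ / 2) / δ) (1 / 2)
    (by norm_num)).comp (tendsto_rpow_atTop hδ0)).comp tendsto_natCast_atTop_atTop
  filter_upwards [hlim.eventually_le_const one_pos, eventually_ge_atTop (2 * k + 2)]
    with n hn hkn hb
  have hn0 : (0 : ℝ) < n := by exact_mod_cast (by omega : 0 < n)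
  simp only [Function.comp_apply] at hn
  rw [← Real.rpow_mul hn0.le, mul_div_cancel₀ _ hδ0.ne'] at hn
  have hpow : (1 - (n : ℝ) ^ (-(1 - δ))) ^ (n - k - 1) ≤ Real.exp (-(1 / 2) * (n : ℝ) ^ δ) := by
    calc _ ≤ Real.exp (-(n : ℝ) ^ (-(1 - δ))) ^ (n - k - 1) :=
          pow_le_pow_left₀ hb.le (Real.one_sub_le_exp_neg _) _
      _ = Real.exp (-(((n - k - 1 : ℕ) : ℝ) * (n : ℝ) ^ (-(1 - δ)))) := by
          rw [← Real.exp_nat_mul]; ring_nf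
      _ ≤ _ := by
          refine Real.exp_le_exp.2 ?_
          have h1 : (n : ℝ) / 2 ≤ ((n - k - 1 : ℕ) : ℝ) := by
            rw [div_le_iff₀ two_pos]
            exact_mod_cast (by omega : n ≤ (n - k - 1) * 2)
          have h2 : (n : ℝ) ^ δ = n * (n : ℝ) ^ (-(1 - δ)) := by
            rw [mul_comm, ← Real.rpow_add_one hn0.ne']
            congr 1
            ring
          have h3 := mul_le_mul_of_nonneg_right h1 (Real.rpow_nonneg hn0.le (-(1 - δ)))
          rw [h2]
          linarith
  have hsplit : (n : ℝ) ^ (1 + δ / 2) = n * (n : ℝ) ^ (δ / 2) := by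
    rw [Real.rpow_add hn0, Real.rpow_one]
  rw [Real.rpow_neg hn0.le (δ / 2), ← one_div, le_div_iff₀ (Real.rpow_pos_of_pos hn0 _)]
  refine le_trans ?_ hn
  rw [hsplit]
  calc _ ≤ n * Real.exp (-(1 / 2) * (n : ℝ) ^ δ) * (n : ℝ) ^ (δ / 2) := by gcongr
    _ = _ := by ring

lemma eventually_nearOne {δ : ℝ} (hδ0 : 0 < δ) (hδ1 : δ < 1) (k : ℕ) :
    ∀ᶠ n : ℕ in atTop,
      NearOne k n ((n : ℝ) ^ (-(δ / 2))) (1 - (n : ℝ) ^ (-(1 - δ))) := by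
  have hlim := ((tendsto_rpow_neg_atTop hδ0).const_mul (100 * ((k : ℝ) + 1) ^ 4)).comp
    tendsto_natCast_atTop_atTop
  rw [mul_zero] at hlim
  filter_upwards [hlim.eventually_le_const one_pos, eventually_ge_atTop (2 * k + 2),
    eventually_natCast_mul_pow_le_rpow hδ0 k] with n hn hkn hpow
  have hn1 : (1 : ℝ) < n := by exact_mod_cast (by omega : 1 < n)
  have hn0 : (0 : ℝ) < n := zero_lt_one.trans hn1
  have hb : 0 < 1 - (n : ℝ) ^ (-(1 - δ)) :=
    sub_pos.2 (Real.rpow_lt_one_of_one_lt_of_neg hn1 (by linarith))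
  refine ⟨hkn, Real.rpow_pos_of_pos hn0 _, ?_, hb, ?_, hpow hb⟩
  · have hexp : -(δ / 2) * ((2 : ℕ) : ℝ) = -δ := by push_cast; ring
    rw [← Real.rpow_natCast ((n : ℝ) ^ _), ← Real.rpow_mul hn0.le, hexp]
    exact hn
  · linarith [Real.rpow_pos_of_pos hn0 (-(1 - δ))]

lemma I1_eq_Icc (δ : ℝ) (n : ℕ) :
    I1 δ n = Set.Icc (1 - ((n : ℝ) ^ (-(δ / 2))) ^ 2) (1 - (n : ℝ) ^ (-(1 - δ))) := by
  rw [I1, ← Real.rpow_natCast, ← Real.rpow_mul n.cast_nonneg]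
  congr 3
  push_cast
  ring

lemma mem_Vset_cases {δ : ℝ} {n : ℕ} {x : ℝ} (hx : x ∈ Vset δ n) :
    ∃ a ∈ I1 δ n, x = a ∨ x = a⁻¹ ∨ x = -a⁻¹ ∨ x = -a := by
  rcases hx with ((hx | ⟨a, ha, rfl⟩) | hx) | hx
  · exact ⟨x, hx, Or.inl rfl⟩
  · exact ⟨a, ha, Or.inr (Or.inl rfl)⟩
  · obtain ⟨a, ha, hax⟩ := Set.mem_neg.1 hx
    exact ⟨a, ha, Or.inr (Or.inr (Or.inl (by rw [hax, neg_neg])))⟩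
  · exact ⟨-x, hx, Or.inr (Or.inr (Or.inr (neg_neg x).symm))⟩

section Uset

variable {δ : ℝ} {n : ℕ} {a c : ℝ}

lemma mem_Uset_I1 (ha : a ∈ I1 δ n) (hc : c ∈ I1 δ n) : (a, c) ∈ Uset δ n :=
  Or.inl (Or.inl (Or.inl ⟨ha, hc⟩))

lemma mem_Uset_I2 (ha : a ∈ I1 δ n) (hc : c ∈ I1 δ n) : (a⁻¹, c⁻¹) ∈ Uset δ n :=
  Or.inl (Or.inl (Or.inr ⟨⟨a, ha, rfl⟩, ⟨c, hc, rfl⟩⟩))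

lemma mem_Uset_I3 (ha : a ∈ I1 δ n) (hc : c ∈ I1 δ n) : (-a⁻¹, -c⁻¹) ∈ Uset δ n :=
  Or.inl (Or.inr ⟨⟨a, ha, (neg_neg _).symm⟩, ⟨c, hc, (neg_neg _).symm⟩⟩)

lemma mem_Uset_I4 (ha : a ∈ I1 δ n) (hc : c ∈ I1 δ n) : (-a, -c) ∈ Uset δ n :=
  Or.inr ⟨Set.neg_mem_neg.2 ha, Set.neg_mem_neg.2 hc⟩

end Uset

/-- For all sufficiently large `n` there is `α_n ∈ [0, n^(-δ/2)]` with
`c̃_n(x,y) ≤ (1-α_n)·χ_U(x,y)/g(x,y) + α_n` for all `x, y ∈ V`, with equality when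
`x = y`. -/
theorem covariance_upper_bound
    (δ : ℝ) (hδ : δ ∈ Set.Ioo (0 : ℝ) (1 / 2))
    (k : ℕ) (hk : 1 ≤ k)
    (S : Finset ℕ) (hS : S ⊆ Finset.Icc 1 k) (hkS : k ∈ S) (h1S : 1 ∉ S) :
    ∀ᶠ n : ℕ in atTop, ∃ α : ℝ, α ∈ Set.Icc (0 : ℝ) ((n : ℝ) ^ (-(δ / 2))) ∧
      (∀ x ∈ Vset δ n, ∀ y ∈ Vset δ n,
        ctil k S n x y ≤
          Set.indicator (Uset δ n) (fun p => (1 - α) / gcov p.1 p.2) (x, y) + α) ∧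
      (∀ x ∈ Vset δ n,
        ctil k S n x x =
          Set.indicator (Uset δ n) (fun p => (1 - α) / gcov p.1 p.2) (x, x) + α) := by
  filter_upwards [eventually_nearOne hδ.1 (by linarith [hδ.2]) k] with n h
  have hkn : k < n := by have := h.le_n; omega
  have hI := I1_eq_Icc δ n
  set α : ℝ := (n : ℝ) ^ (-(δ / 2))
  have hB := isGap_image_sub hS hkn
  refine ⟨α, ⟨h.α_pos.le, le_rfl⟩, fun x hx y hy => ?_, fun x hx => ?_⟩
  · have hα1 : 0 ≤ 1 - α := by linarith [h.α_le_tenth]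
    obtain ⟨a, ha, hxa⟩ := mem_Vset_cases hx
    obtain ⟨c, hc, hyc⟩ := mem_Vset_cases hy
    have ha' := hI ▸ ha
    have hc' := hI ▸ hc
    have ha0 := h.pos_of_mem ha'
    have hc0 := h.pos_of_mem hc'
    have hnonneg : 0 ≤ Set.indicator (Uset δ n) (fun p => (1 - α) / gcov p.1 p.2) (x, y) :=
      Set.indicator_nonneg (fun p _ => div_nonneg hα1 (gcov_nonneg _ _)) _
    have hinside : (x, y) ∈ Uset δ n →
        gapCorr n (S.image fun i => n - i) x y ≤ (1 - α) / gcov x y + α →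
        ctil k S n x y ≤
          Set.indicator (Uset δ n) (fun p => (1 - α) / gcov p.1 p.2) (x, y) + α := by
      intro hU hle
      rwa [ctil_eq_gapCorr hS hkn, Set.indicator_of_mem hU]
    have houtside : |gapCorr n (S.image fun i => n - i) x y| ≤ α → ctil k S n x y ≤
        Set.indicator (Uset δ n) (fun p => (1 - α) / gcov p.1 p.2) (x, y) + α := by
      intro hle
      rw [ctil_eq_gapCorr hS hkn]
      linarith [le_abs_self (gapCorr n (S.image fun i => n - i) x y)]
    have hsame := h.gapCorr_le hB ha' hc'
    have hsame_inv : gapCorr n (S.image fun i => n - i) a⁻¹ c⁻¹ ≤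
        (1 - α) / gcov a⁻¹ c⁻¹ + α := by
      rw [gapCorr_inv_inv_of_pos hB.lt ha0 hc0, gcov_inv_inv ha0.ne' hc0.ne']
      exact h.gapCorr_le hB.reflect ha' hc'
    have hopp := h.abs_gapCorr_neg_le hB ha' hc'
    have hopp_inv : |gapCorr n (S.image fun i => n - i) a⁻¹ (-c⁻¹)| ≤ α := by
      rw [← inv_neg, abs_gapCorr_inv_inv hB.lt ha0.ne' (neg_ne_zero.2 hc0.ne')]
      exact h.abs_gapCorr_neg_le hB.reflect ha' hc'
    have hmixed : ∀ {u v : ℝ}, u ∈ Set.Icc (1 - α ^ 2) (1 - (n : ℝ) ^ (-(1 - δ))) →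
        v ∈ Set.Icc (1 - α ^ 2) (1 - (n : ℝ) ^ (-(1 - δ))) →
        |gapCorr n (S.image fun i => n - i) u v⁻¹| ≤ α ∧
          |gapCorr n (S.image fun i => n - i) u (-v⁻¹)| ≤ α := by
      intro u v hu hv
      have hv' : |v| ∈ Set.Icc (1 - α ^ 2) (1 - (n : ℝ) ^ (-(1 - δ))) := by
        rwa [abs_of_pos (h.pos_of_mem hv)]
      refine ⟨h.abs_gapCorr_inv_le hB hu hv', ?_⟩
      rw [← inv_neg]
      exact h.abs_gapCorr_inv_le hB hu (by rwa [abs_neg])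
    obtain ⟨hac, hac_neg⟩ := hmixed ha' hc'
    obtain ⟨hca, hca_neg⟩ := hmixed hc' ha'
    rcases hxa with rfl | rfl | rfl | rfl <;> rcases hyc with rfl | rfl | rfl | rfl
    · exact hinside (mem_Uset_I1 ha hc) hsame
    · exact houtside hac
    · exact houtside hac_neg
    · exact houtside hopp
    · exact houtside (by rwa [gapCorr_comm])
    · exact hinside (mem_Uset_I2 ha hc) hsame_inv
    · exact houtside hopp_inv
    · exact houtside (by rwa [gapCorr_comm, gapCorr_neg_left])
    · exact houtside (by rwa [gapCorr_comm])
    · exact houtside (by rwa [gapCorr_neg_left])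
    · exact hinside (mem_Uset_I3 ha hc) (by rwa [gapCorr_neg_neg, gcov_neg_neg])
    · exact houtside (by rwa [gapCorr_neg_neg, gapCorr_comm])
    · exact houtside (by rwa [gapCorr_neg_left])
    · exact houtside (by rwa [gapCorr_neg_left])
    · exact houtside (by rwa [gapCorr_neg_neg])
    · exact hinside (mem_Uset_I4 ha hc) (by rwa [gapCorr_neg_neg, gcov_neg_neg])
  · obtain ⟨a, ha, hxa⟩ := mem_Vset_cases hx
    have ha' := hI ▸ ha
    have ha0 := h.pos_of_mem ha'
    have hg : gcov a a = 1 := gcov_self (h.one_sub_sq_mem ha' |>.1 |> sub_pos.1 |>.ne)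
    have hfacts : (x, x) ∈ Uset δ n ∧ gcov x x = 1 ∧ x ≠ 0 := by
      rcases hxa with rfl | rfl | rfl | rfl
      · exact ⟨mem_Uset_I1 ha ha, hg, ha0.ne'⟩
      · exact ⟨mem_Uset_I2 ha ha, by rwa [gcov_inv_inv ha0.ne' ha0.ne'], inv_ne_zero ha0.ne'⟩
      · exact ⟨mem_Uset_I3 ha ha, by rwa [gcov_neg_neg, gcov_inv_inv ha0.ne' ha0.ne'],
          neg_ne_zero.2 (inv_ne_zero ha0.ne')⟩
      · exact ⟨mem_Uset_I4 ha ha, by rwa [gcov_neg_neg], neg_ne_zero.2 ha0.ne'⟩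
    obtain ⟨hU, hgx, hx0⟩ := hfacts
    rw [ctil_eq_gapCorr hS hkn, gapCorr_self hB h.le_n hx0, Set.indicator_of_mem hU, hgx]
    ring
end

section
/- For all sufficiently large n (depending only on k and δ) and all x, y ∈ I_2, one has g(x,y)·\tilde c_n(x,y) ≤ 1. -/
open Filter Real Topology

/-- The function `p` for which `z ^ (m - 1) * p z - 1` is `z - 1` times
`z ^ (m - 1) * ∑ e ∈ E, z ^ e + ∑ i ∈ Finset.Icc 1 m, z ^ (m - i)`. -/
noncomputable def tailPoly (E : Finset ℕ) (z : ℝ) : ℝ := z + (z - 1) * ∑ e ∈ E, z ^ e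

lemma tailPoly_eq (E : Finset ℕ) (z : ℝ) :
    tailPoly E z = z + ∑ e ∈ E, (z ^ (e + 1) - z ^ e) := by
  simp only [tailPoly, Finset.mul_sum]
  congr 1
  exact Finset.sum_congr rfl fun e _ => by ring

/-- The homogeneous geometric sum, i.e. `(x ^ a - y ^ a) / (x - y)`. -/
noncomputable def geomSumTwo (a : ℕ) (x y : ℝ) : ℝ :=
  ∑ i ∈ Finset.range a, x ^ i * y ^ (a - 1 - i)

lemma geomSumTwo_mul (a : ℕ) (x y : ℝ) : geomSumTwo a x y * (x - y) = x ^ a - y ^ a :=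
  (Commute.all x y).geom_sum₂_mul a

lemma geomSumTwo_one (a : ℕ) : geomSumTwo a 1 1 = a := by
  simp [geomSumTwo]

lemma continuous_geomSumTwo (a : ℕ) {X : Type*} [TopologicalSpace X] {f g : X → ℝ}
    (hf : Continuous f) (hg : Continuous g) : Continuous fun q => geomSumTwo a (f q) (g q) := by
  unfold geomSumTwo
  fun_prop

/-- The divided difference of `tailPoly E`. -/
noncomputable def tailSlope (E : Finset ℕ) (s t : ℝ) : ℝ :=
  1 + ∑ e ∈ E, (geomSumTwo (e + 1) s t - geomSumTwo e s t)

/-- The quotient of `p(x²) + p(y²) - 2p(xy)` by `(x - y)²` for `p = tailPoly E`. -/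
noncomputable def tailCurv (E : Finset ℕ) (x y : ℝ) : ℝ :=
  1 + ∑ e ∈ E, (geomSumTwo (e + 1) x y ^ 2 - geomSumTwo e x y ^ 2)

lemma tailSlope_mul (E : Finset ℕ) (s t : ℝ) :
    tailSlope E s t * (s - t) = tailPoly E s - tailPoly E t := by
  have h : ∑ e ∈ E, (geomSumTwo (e + 1) s t - geomSumTwo e s t) * (s - t) =
      ∑ e ∈ E, ((s ^ (e + 1) - s ^ e) - (t ^ (e + 1) - t ^ e)) :=
    Finset.sum_congr rfl fun e _ => by
      linear_combination geomSumTwo_mul (e + 1) s t - geomSumTwo_mul e s t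
  rw [tailSlope, add_mul, Finset.sum_mul, h, tailPoly_eq, tailPoly_eq, Finset.sum_sub_distrib]
  ring

lemma tailCurv_mul (E : Finset ℕ) (x y : ℝ) :
    tailCurv E x y * (x - y) ^ 2 =
      tailPoly E (x ^ 2) + tailPoly E (y ^ 2) - 2 * tailPoly E (x * y) := by
  have hsq (a : ℕ) : geomSumTwo a x y ^ 2 * (x - y) ^ 2 = (x ^ a - y ^ a) ^ 2 := by
    rw [← mul_pow, geomSumTwo_mul]
  have h : ∑ e ∈ E, (geomSumTwo (e + 1) x y ^ 2 - geomSumTwo e x y ^ 2) * (x - y) ^ 2 =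
      ∑ e ∈ E, (((x ^ 2) ^ (e + 1) - (x ^ 2) ^ e) + ((y ^ 2) ^ (e + 1) - (y ^ 2) ^ e)
        - 2 * ((x * y) ^ (e + 1) - (x * y) ^ e)) :=
    Finset.sum_congr rfl fun e _ => by
      linear_combination hsq (e + 1) - hsq e
  rw [tailCurv, add_mul, Finset.sum_mul, h, tailPoly_eq, tailPoly_eq, tailPoly_eq,
    Finset.sum_sub_distrib, Finset.sum_add_distrib, ← Finset.mul_sum]
  ring

lemma card_sq_le_sum (E : Finset ℕ) (h2 : ∀ e ∈ E, 2 ≤ e) :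
    E.card ^ 2 + 3 * E.card ≤ 2 * ∑ e ∈ E, e := by
  induction E using Finset.induction_on_max with
  | empty => simp
  | insert a s hs ih =>
    have ha : a ∉ s := fun h => (hs a h).false
    have ih' := ih fun e he => h2 e (Finset.mem_insert_of_mem he)
    have hsub : s ⊆ Finset.Ico 2 a := fun e he =>
      Finset.mem_Ico.2 ⟨h2 e (Finset.mem_insert_of_mem he), hs e he⟩
    have hcard := Finset.card_le_card hsub
    have h2a := h2 a (Finset.mem_insert_self a s)
    rw [Nat.card_Ico] at hcard
    rw [Finset.sum_insert ha, Finset.card_insert_of_notMem ha]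
    have : s.card + 2 ≤ a := by omega
    nlinarith

lemma eventually_sq_sub_le_tailPoly (E : Finset ℕ) (h2 : ∀ e ∈ E, 2 ≤ e) (hE : E.Nonempty) :
    ∀ᶠ q : ℝ × ℝ in 𝓝 (1, 1), (q.1 - q.2) ^ 2 ≤
      tailPoly E (q.1 ^ 2) * tailPoly E (q.2 ^ 2) - tailPoly E (q.1 * q.2) ^ 2 := by
  let G : ℝ × ℝ → ℝ := fun q => tailPoly E (q.1 * q.2) * tailCurv E q.1 q.2 -
    q.1 * q.2 * (tailSlope E (q.1 ^ 2) (q.1 * q.2) * tailSlope E (q.2 ^ 2) (q.1 * q.2))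
  have hG : Continuous G := by
    have h1 := fun a => continuous_geomSumTwo a (continuous_fst (X := ℝ) (Y := ℝ)) continuous_snd
    have h3 := fun a => continuous_geomSumTwo a (X := ℝ × ℝ) (f := fun q => q.1 ^ 2)
      (g := fun q => q.1 * q.2) (by fun_prop) (by fun_prop)
    have h4 := fun a => continuous_geomSumTwo a (X := ℝ × ℝ) (f := fun q => q.2 ^ 2)
      (g := fun q => q.1 * q.2) (by fun_prop) (by fun_prop)
    simp only [G, tailPoly, tailCurv, tailSlope]
    fun_prop
  have hG1 : 1 < G (1, 1) := by
    have hc : 1 ≤ (E.card : ℝ) := by exact_mod_cast hE.card_pos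
    have hs : (E.card : ℝ) ^ 2 + 3 * E.card ≤ 2 * ∑ e ∈ E, (e : ℝ) := by
      have := Nat.cast_le (α := ℝ).2 (card_sq_le_sum E h2)
      push_cast at this
      exact this
    have hcurv : tailCurv E 1 1 = 1 + (2 * ∑ e ∈ E, (e : ℝ) + E.card) := by
      simp only [tailCurv, geomSumTwo_one]
      have : ∀ e ∈ E, ((e + 1 : ℕ) : ℝ) ^ 2 - (e : ℝ) ^ 2 = 2 * e + 1 := fun e _ => by
        push_cast; ring
      rw [Finset.sum_congr rfl this, Finset.sum_add_distrib, ← Finset.mul_sum]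
      simp
    have hslope : tailSlope E 1 1 = 1 + E.card := by
      simp [tailSlope, geomSumTwo_one]
    have hp : tailPoly E 1 = 1 := by simp [tailPoly]
    simp only [G, one_pow, mul_one, one_mul, hcurv, hslope, hp]
    nlinarith
  filter_upwards [hG.continuousAt.eventually (lt_mem_nhds hG1)] with q hq
  have key : tailPoly E (q.1 ^ 2) * tailPoly E (q.2 ^ 2) - tailPoly E (q.1 * q.2) ^ 2 =
      (q.1 - q.2) ^ 2 * G q := by
    have hU := tailCurv_mul E q.1 q.2
    have hV := tailSlope_mul E (q.1 ^ 2) (q.1 * q.2)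
    have hW := tailSlope_mul E (q.2 ^ 2) (q.1 * q.2)
    have hprod := congrArg₂ (· * ·) hV hW
    simp only [G]
    linear_combination (-tailPoly E (q.1 * q.2)) * hU - hprod
  rw [key]
  nlinarith [sq_nonneg (q.1 - q.2)]

lemma sq_pow_sub_pow_le {x y : ℝ} (hx : 1 ≤ x) (hxy : x ≤ y) (hy : y ≤ 2) {j k a : ℕ}
    (ha : a ≤ j + k + 1) :
    (x ^ a - y ^ a) ^ 2 ≤ ((j + k + 1 : ℕ) : ℝ) ^ 2 * 4 ^ k * y ^ (2 * j) * (x - y) ^ 2 := by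
  have h1y : 1 ≤ y := hx.trans hxy
  have h0 : 0 ≤ geomSumTwo a x y := by
    unfold geomSumTwo; positivity
  have hle : geomSumTwo a x y ≤ ((j + k + 1 : ℕ) : ℝ) * (y ^ j * 2 ^ k) := by
    calc geomSumTwo a x y ≤ ∑ i ∈ Finset.range a, y ^ j * 2 ^ k := by
          refine Finset.sum_le_sum fun i hi => ?_
          have hi' := Finset.mem_range.1 hi
          calc x ^ i * y ^ (a - 1 - i) ≤ y ^ i * y ^ (a - 1 - i) := by gcongr
            _ = y ^ (i + (a - 1 - i)) := (pow_add _ _ _).symm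
            _ ≤ y ^ (j + k) := pow_le_pow_right₀ h1y (by omega)
            _ = y ^ j * y ^ k := pow_add _ _ _
            _ ≤ y ^ j * 2 ^ k := by gcongr
      _ = (a : ℝ) * (y ^ j * 2 ^ k) := by simp
      _ ≤ _ := by
          have : (a : ℝ) ≤ ((j + k + 1 : ℕ) : ℝ) := by exact_mod_cast ha
          gcongr
  have h4 : (4 : ℝ) ^ k = (2 ^ k) ^ 2 := by rw [← pow_mul, mul_comm, pow_mul]; norm_num
  rw [← geomSumTwo_mul, mul_pow]
  refine mul_le_mul_of_nonneg_right ?_ (sq_nonneg _)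
  calc geomSumTwo a x y ^ 2 ≤ (((j + k + 1 : ℕ) : ℝ) * (y ^ j * 2 ^ k)) ^ 2 := by gcongr
    _ = _ := by rw [h4]; ring

lemma pow_mul_tailPoly_le (E : Finset ℕ) {j k : ℕ} (hk : ∀ e ∈ E, e ≤ k) {x y : ℝ}
    (hx : 1 ≤ x) (hxy : x ≤ y) (hy : y ≤ 2) :
    (x ^ 2) ^ j * tailPoly E (x ^ 2) + (y ^ 2) ^ j * tailPoly E (y ^ 2)
        - 2 * ((x * y) ^ j * tailPoly E (x * y)) ≤
      (1 + E.card) * (((j + k + 1 : ℕ) : ℝ) ^ 2 * 4 ^ k * y ^ (2 * j) * (x - y) ^ 2) := by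
  have hexp (z : ℝ) : z ^ j * tailPoly E z =
      z ^ (j + 1) + ∑ e ∈ E, (z ^ (j + e + 1) - z ^ (j + e)) := by
    rw [tailPoly_eq, mul_add, Finset.mul_sum]
    congr 1
    exact Finset.sum_congr rfl fun e _ => by ring
  have heq : (x ^ 2) ^ j * tailPoly E (x ^ 2) + (y ^ 2) ^ j * tailPoly E (y ^ 2)
        - 2 * ((x * y) ^ j * tailPoly E (x * y)) =
      (x ^ (j + 1) - y ^ (j + 1)) ^ 2 +
        ∑ e ∈ E, ((x ^ (j + e + 1) - y ^ (j + e + 1)) ^ 2 - (x ^ (j + e) - y ^ (j + e)) ^ 2) := by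
    have hsum : ∑ e ∈ E, ((x ^ (j + e + 1) - y ^ (j + e + 1)) ^ 2 -
          (x ^ (j + e) - y ^ (j + e)) ^ 2) =
        ∑ e ∈ E, (((x ^ 2) ^ (j + e + 1) - (x ^ 2) ^ (j + e)) +
          ((y ^ 2) ^ (j + e + 1) - (y ^ 2) ^ (j + e)) -
          2 * ((x * y) ^ (j + e + 1) - (x * y) ^ (j + e))) :=
      Finset.sum_congr rfl fun e _ => by ring
    rw [hexp, hexp, hexp, hsum]
    simp only [Finset.sum_sub_distrib, Finset.sum_add_distrib, ← Finset.mul_sum]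
    ring
  rw [heq, add_mul, one_mul]
  refine add_le_add (sq_pow_sub_pow_le hx hxy hy (by omega)) ?_
  rw [← nsmul_eq_mul]
  refine Finset.sum_le_card_nsmul _ _ _ fun e he => ?_
  have := hk e he
  have := sq_pow_sub_pow_le hx hxy hy (show j + e + 1 ≤ j + k + 1 by omega)
  nlinarith [sq_nonneg (x ^ (j + e) - y ^ (j + e))]

/-- The Cauchy–Schwarz type inequality for `z ^ j * tailPoly E z - 1`. -/
lemma sq_pow_mul_tailPoly_sub_one_le (E : Finset ℕ) {j k : ℕ} (hk : ∀ e ∈ E, e ≤ k) {x y : ℝ}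
    (hx : 1 ≤ x) (hxy : x ≤ y) (hy : y ≤ 2)
    (hquad : (x - y) ^ 2 ≤ tailPoly E (x ^ 2) * tailPoly E (y ^ 2) - tailPoly E (x * y) ^ 2)
    (hgrow : (1 + E.card) * (((j + k + 1 : ℕ) : ℝ) ^ 2 * 4 ^ k) ≤ x ^ (2 * j)) :
    ((x * y) ^ j * tailPoly E (x * y) - 1) ^ 2 ≤
      ((x ^ 2) ^ j * tailPoly E (x ^ 2) - 1) * ((y ^ 2) ^ j * tailPoly E (y ^ 2) - 1) := by
  have h1 := pow_mul_tailPoly_le E (j := j) hk hx hxy hy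
  have h2 : (1 + E.card) * (((j + k + 1 : ℕ) : ℝ) ^ 2 * 4 ^ k * y ^ (2 * j) * (x - y) ^ 2) ≤
      x ^ (2 * j) * y ^ (2 * j) * (x - y) ^ 2 := by
    have h0 : 0 ≤ y ^ (2 * j) * (x - y) ^ 2 := by
      have : 0 ≤ y := by linarith
      positivity
    linarith [mul_le_mul_of_nonneg_right hgrow h0]
  have h3 : x ^ (2 * j) * y ^ (2 * j) * (x - y) ^ 2 ≤ x ^ (2 * j) * y ^ (2 * j) *
      (tailPoly E (x ^ 2) * tailPoly E (y ^ 2) - tailPoly E (x * y) ^ 2) := by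
    have : 0 ≤ y := by linarith
    gcongr
  have h4 : ((x ^ 2) ^ j * tailPoly E (x ^ 2) - 1) * ((y ^ 2) ^ j * tailPoly E (y ^ 2) - 1) -
      ((x * y) ^ j * tailPoly E (x * y) - 1) ^ 2 = x ^ (2 * j) * y ^ (2 * j) *
      (tailPoly E (x ^ 2) * tailPoly E (y ^ 2) - tailPoly E (x * y) ^ 2) -
      ((x ^ 2) ^ j * tailPoly E (x ^ 2) + (y ^ 2) ^ j * tailPoly E (y ^ 2)
        - 2 * ((x * y) ^ j * tailPoly E (x * y))) := by ring
  linarith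

lemma rIndexed_eq_sum_image (k : ℕ) (S : Finset ℕ) (z : ℝ) :
    rIndexed k S z = ∑ e ∈ (Finset.Icc 1 k \ S).image (fun i => k + 1 - i), z ^ e := by
  rw [rIndexed, Finset.sum_image]
  intro a ha b hb hab
  simp only [Finset.coe_sdiff, Set.mem_sdiff, Finset.mem_coe, Finset.mem_Icc] at ha hb
  simp only at hab
  omega

lemma sub_one_mul_numerator (E : Finset ℕ) (m : ℕ) (hm : 1 ≤ m) (z : ℝ) :
    (z - 1) * (z ^ (m - 1) * ∑ e ∈ E, z ^ e + ∑ i ∈ Finset.Icc 1 m, z ^ (m - i)) =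
      z ^ (m - 1) * tailPoly E z - 1 := by
  have hgeom : ∑ i ∈ Finset.Icc 1 m, z ^ (m - i) = ∑ i ∈ Finset.range m, z ^ i := by
    rw [← Finset.sum_range_reflect, Finset.range_eq_Ico, Finset.sum_Ico_eq_sum_range,
      ← Finset.Ico_add_one_right_eq_Icc, Finset.sum_Ico_eq_sum_range]
    refine Finset.sum_congr (by simp) fun i _ => ?_
    congr 1
    omega
  obtain ⟨j, rfl⟩ : ∃ j, m = j + 1 := ⟨m - 1, by omega⟩
  rw [hgeom, mul_add, mul_geom_sum, tailPoly]
  simp only [Nat.add_sub_cancel]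
  ring

lemma gcov_mul_ctil_le_one {k n : ℕ} {S : Finset ℕ} {x y : ℝ} (hx : 1 < x) (hy : 1 < y)
    (hn : k < n) (E : Finset ℕ) (hr : ∀ z, rIndexed k S z = ∑ e ∈ E, z ^ e)
    (h : ((x * y) ^ (n - k - 1) * tailPoly E (x * y) - 1) ^ 2 ≤
      ((x ^ 2) ^ (n - k - 1) * tailPoly E (x ^ 2) - 1) *
        ((y ^ 2) ^ (n - k - 1) * tailPoly E (y ^ 2) - 1)) :
    gcov x y * ctil k S n x y ≤ 1 := by
  have hx2 : 0 < x ^ 2 - 1 := by nlinarith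
  have hy2 : 0 < y ^ 2 - 1 := by nlinarith
  have hxy : 0 < x * y - 1 := by nlinarith
  have hm : 1 ≤ n - k := by omega
  rw [← sub_one_mul_numerator E (n - k) hm, ← sub_one_mul_numerator E (n - k) hm,
    ← sub_one_mul_numerator E (n - k) hm] at h
  simp only [gcov, ctil, hr, pow_mul]
  rw [abs_of_pos hxy, abs_of_pos (mul_pos hx2 hy2), div_mul_div_comm,
    ← Real.sqrt_mul (mul_pos hx2 hy2).le]
  refine div_le_one_of_le₀ (Real.le_sqrt_of_sq_le ?_) (Real.sqrt_nonneg _)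
  calc _ ≤ _ := h
    _ = _ := by ring

lemma eventually_const_mul_sq_le_exp_rpow {δ : ℝ} (hδ : 0 < δ) (C : ℝ) :
    ∀ᶠ n : ℕ in atTop, C * (n : ℝ) ^ 2 ≤ Real.exp ((n : ℝ) ^ δ) := by
  have h1 : Tendsto (fun n : ℕ => (n : ℝ) ^ δ) atTop atTop :=
    (tendsto_rpow_atTop hδ).comp tendsto_natCast_atTop_atTop
  filter_upwards [((tendsto_exp_div_rpow_atTop (2 / δ)).comp h1).eventually_ge_atTop C,
    eventually_gt_atTop 0] with n hn hpos
  have hn0 : (0 : ℝ) < n := by exact_mod_cast hpos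
  have hpow : ((n : ℝ) ^ δ) ^ (2 / δ) = (n : ℝ) ^ 2 := by
    rw [← Real.rpow_mul hn0.le, mul_div_cancel₀ _ hδ.ne', Real.rpow_two]
  simp only [Function.comp_apply, hpow] at hn
  rwa [le_div_iff₀ (by positivity)] at hn

lemma exp_rpow_le_pow_of_mem_I2 {δ : ℝ} {n j : ℕ} {x : ℝ} (hn : 0 < n) (hj : n ≤ 2 * j)
    (h1 : (n : ℝ) ^ (-δ) < 1) (hx : x ∈ I2 δ n) : Real.exp ((n : ℝ) ^ δ) ≤ x ^ (2 * j) := by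
  have hn0 : (0 : ℝ) < n := by exact_mod_cast hn
  obtain ⟨w, ⟨hw1, hw2⟩, rfl⟩ := hx
  have hw0 : 0 < w := by linarith
  have hexp : Real.exp ((n : ℝ) ^ (-(1 - δ))) ≤ w⁻¹ := by
    rw [le_inv_comm₀ (Real.exp_pos _) hw0, ← Real.exp_neg]
    linarith [Real.add_one_le_exp (-(n : ℝ) ^ (-(1 - δ)))]
  calc Real.exp ((n : ℝ) ^ δ) ≤ Real.exp (((2 * j : ℕ) : ℝ) * (n : ℝ) ^ (-(1 - δ))) := by
        refine Real.exp_le_exp.2 ?_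
        have : (n : ℝ) ^ δ = n * (n : ℝ) ^ (-(1 - δ)) := by
          nth_rewrite 2 [← Real.rpow_one (n : ℝ)]
          rw [← Real.rpow_add hn0]
          ring_nf
        rw [this]
        gcongr
    _ = Real.exp ((n : ℝ) ^ (-(1 - δ))) ^ (2 * j) := Real.exp_nat_mul _ _
    _ ≤ _ := by gcongr

lemma mem_I2_bounds {δ ε : ℝ} {n : ℕ} {x : ℝ} (hn : 0 < n) (hε : 0 < ε)
    (h1 : (n : ℝ) ^ (-δ) < ε / (1 + ε)) (hx : x ∈ I2 δ n) : 1 < x ∧ x < 1 + ε := by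
  have hn0 : (0 : ℝ) < n := by exact_mod_cast hn
  obtain ⟨w, ⟨hw1, hw2⟩, rfl⟩ := hx
  have hε1 : 1 - ε / (1 + ε) = (1 + ε)⁻¹ := by field_simp; ring
  have hw : (1 + ε)⁻¹ < w := by linarith
  have hw0 : 0 < w := lt_trans (by positivity) hw
  have ht : 0 < (n : ℝ) ^ (-(1 - δ)) := by positivity
  exact ⟨(one_lt_inv₀ hw0).2 (by linarith), inv_lt_of_inv_lt₀ (by positivity) hw⟩

/-- For all sufficiently large `n` (depending only on `k` and `δ`) and
all `x, y ∈ I₂`, one has `g(x,y)·c̃_n(x,y) ≤ 1`. -/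
theorem covariance_product_le_one
    (δ : ℝ) (hδ : δ ∈ Set.Ioo (0 : ℝ) (1 / 2))
    (k : ℕ) (hk : 1 ≤ k)
    (S : Finset ℕ) (hS : S ⊆ Finset.Icc 1 k) (hkS : k ∈ S) (h1S : 1 ∉ S) :
    ∃ N : ℕ, ∀ n : ℕ, N ≤ n →
      ∀ x ∈ I2 δ n, ∀ y ∈ I2 δ n, gcov x y * ctil k S n x y ≤ 1 := by
  set E := (Finset.Icc 1 k \ S).image (fun i => k + 1 - i)
  have hmem : ∀ e ∈ E, 2 ≤ e ∧ e ≤ k := by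
    intro e he
    obtain ⟨i, hi, rfl⟩ := Finset.mem_image.1 he
    obtain ⟨hi, hiS⟩ := Finset.mem_sdiff.1 hi
    have hik : i ≠ k := fun h => hiS (h ▸ hkS)
    rw [Finset.mem_Icc] at hi
    omega
  have hne : E.Nonempty := Finset.Nonempty.image
    ⟨1, Finset.mem_sdiff.2 ⟨Finset.mem_Icc.2 ⟨le_rfl, hk⟩, h1S⟩⟩ _
  obtain ⟨ε, hε, hquad⟩ := Metric.eventually_nhds_iff.1
    (eventually_sq_sub_le_tailPoly E (fun e he => (hmem e he).1) hne)
  have hη : 0 < min ε 1 := lt_min hε one_pos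
  have hzero : Tendsto (fun n : ℕ => (n : ℝ) ^ (-δ)) atTop (𝓝 0) :=
    (tendsto_rpow_neg_atTop hδ.1).comp tendsto_natCast_atTop_atTop
  obtain ⟨N, hN⟩ := eventually_atTop.1
    ((eventually_const_mul_sq_le_exp_rpow hδ.1 ((1 + E.card) * 4 ^ k)).and
      ((hzero.eventually (gt_mem_nhds (show 0 < min ε 1 / (1 + min ε 1) by positivity))).and
        ((hzero.eventually (gt_mem_nhds one_pos)).and (eventually_ge_atTop (2 * k + 2)))))
  refine ⟨N, fun n hn x hx y hy => ?_⟩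
  obtain ⟨hgrow, hsmall, hlt, hnk⟩ := hN n hn
  obtain ⟨hx1, hxε⟩ := mem_I2_bounds (by omega) hη hsmall hx
  obtain ⟨hy1, hyε⟩ := mem_I2_bounds (by omega) hη hsmall hy
  refine gcov_mul_ctil_le_one hx1 hy1 (by omega) E (rIndexed_eq_sum_image k S) ?_
  wlog hxy : x ≤ y generalizing x y
  · have := this y hy x hx hy1 hyε hx1 hxε (le_of_not_ge hxy)
    rwa [mul_comm y x, mul_comm ((y ^ 2) ^ _ * _ - 1)] at this
  refine sq_pow_mul_tailPoly_sub_one_le E (fun e he => (hmem e he).2) hx1.le hxy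
    (by linarith [min_le_right ε 1]) ?_ ?_
  · refine hquad (y := (x, y)) ?_
    rw [Prod.dist_eq, max_lt_iff, Real.dist_eq, Real.dist_eq, abs_of_pos (sub_pos.2 hx1),
      abs_of_pos (sub_pos.2 hy1)]
    constructor <;> linarith [min_le_left ε 1]
  · rw [show n - k - 1 + k + 1 = n by omega]
    calc _ = (1 + E.card) * 4 ^ k * (n : ℝ) ^ 2 := by ring
      _ ≤ _ := hgrow
      _ ≤ _ := exp_rpow_le_pow_of_mem_I2 (by omega) (by omega) hlt hx
end

section
/- Let {T_x : x ∈ [a,b]} be an almost surely continuous real-valued stochastic process with T_a = 0, and suppose there is K > 0 with E[|T_x - T_y|²] ≤ K(x-y)² for all x, y ∈ [a,b]. Then E[ sup_{x∈[a,b]} T_x² ] ≤ 4K(b-a)². -/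
open MeasureTheory ProbabilityTheory Filter Real Topology

/-- A sequence started at `0` is bounded at every step `k ≤ n` by its increments, in square, via
the Cauchy–Schwarz inequality. -/
theorem sq_le_mul_sum_sq_increments (u : ℕ → ℝ) (hu : u 0 = 0) {k n : ℕ} (hk : k ≤ n) :
    u k ^ 2 ≤ n * ∑ i ∈ Finset.range n, (u (i + 1) - u i) ^ 2 := by
  have hsum : u k = ∑ i ∈ Finset.range k, (u (i + 1) - u i) := by
    rw [Finset.sum_range_sub, hu, sub_zero]
  calc u k ^ 2 ≤ k * ∑ i ∈ Finset.range k, (u (i + 1) - u i) ^ 2 := by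
        rw [hsum]
        simpa using sq_sum_le_card_mul_sum_sq (s := Finset.range k)
          (f := fun i => u (i + 1) - u i)
    _ ≤ n * ∑ i ∈ Finset.range n, (u (i + 1) - u i) ^ 2 := by
        have hsub : Finset.range k ⊆ Finset.range n := Finset.range_subset_range.2 hk
        gcongr

/-- The `i`-th point of the uniform subdivision of `[a, b]` into `n` intervals. -/
noncomputable def uniformGrid (a b : ℝ) (n i : ℕ) : ℝ := a + (i / n : ℝ) * (b - a)

theorem uniformGrid_zero (a b : ℝ) (n : ℕ) : uniformGrid a b n 0 = a := by
  simp [uniformGrid]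

theorem uniformGrid_mem_Icc {a b : ℝ} (hab : a ≤ b) {n i : ℕ} (hi : i ≤ n) :
    uniformGrid a b n i ∈ Set.Icc a b := by
  have h₀ : (0 : ℝ) ≤ i / n := by positivity
  have h₁ : (i / n : ℝ) ≤ 1 := div_le_one_of_le₀ (by exact_mod_cast hi) (by positivity)
  have h₂ : 0 ≤ b - a := sub_nonneg.2 hab
  constructor <;> unfold uniformGrid <;> nlinarith

theorem uniformGrid_succ_sub (a b : ℝ) (n i : ℕ) :
    uniformGrid a b n (i + 1) - uniformGrid a b n i = (b - a) / n := by
  unfold uniformGrid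
  push_cast
  ring

/-- Every point of `[a, b]` is a limit of points of the uniform subdivisions. -/
theorem exists_tendsto_uniformGrid {a b x : ℝ} (hx : x ∈ Set.Icc a b) :
    ∃ k : ℕ → ℕ, (∀ n, k n ≤ n) ∧ Tendsto (fun n => uniformGrid a b n (k n)) atTop (𝓝 x) := by
  have hxa : 0 ≤ x - a := sub_nonneg.2 hx.1
  have hba : 0 ≤ b - a := by linarith [hx.2]
  set t := (x - a) / (b - a) with ht
  have ht₀ : 0 ≤ t := div_nonneg hxa hba
  have ht₁ : t ≤ 1 := div_le_one_of_le₀ (by linarith [hx.2]) hba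
  refine ⟨fun n => ⌊t * n⌋₊, fun n => ?_, ?_⟩
  · exact Nat.floor_le_of_le (mul_le_of_le_one_left n.cast_nonneg ht₁)
  · have hlim := (((tendsto_nat_floor_mul_div_atTop ht₀).comp
      (tendsto_natCast_atTop_atTop (R := ℝ))).mul_const (b - a)).const_add a
    have hval : a + t * (b - a) = x := by
      rw [ht, div_mul_cancel_of_imp (fun h => by linarith [hx.2]), add_sub_cancel]
    rw [hval] at hlim
    exact hlim

/-- If `{T_x : x ∈ [a,b]}` is an almost surely continuous process with
`T_a = 0` and `E|T_x - T_y|² ≤ K(x-y)²`, then `E[sup_{x∈[a,b]} T_x²] ≤ 4K(b-a)²`. -/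
theorem sup_square_expectation_bound
    {Ω : Type*} [MeasureSpace Ω] [IsProbabilityMeasure (ℙ : Measure Ω)]
    (a b : ℝ) (hab : a ≤ b)
    (T : ℝ → Ω → ℝ)
    (hmeas : ∀ x, Measurable (T x))
    (hcont : ∀ᵐ ω ∂ℙ, ContinuousOn (fun x => T x ω) (Set.Icc a b))
    (hTa : ∀ᵐ ω ∂ℙ, T a ω = 0)
    (K : ℝ) (hK : 0 < K)
    (hincr : ∀ x ∈ Set.Icc a b, ∀ y ∈ Set.Icc a b,
      ∫⁻ ω, ENNReal.ofReal ((T x ω - T y ω) ^ 2) ∂ℙ ≤ ENNReal.ofReal (K * (x - y) ^ 2)) :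
    ∫⁻ ω, ⨆ x ∈ Set.Icc a b, ENNReal.ofReal ((T x ω) ^ 2) ∂ℙ ≤
      ENNReal.ofReal (4 * K * (b - a) ^ 2) := by
  let g := uniformGrid a b
  let W : ℕ → Ω → ENNReal := fun n ω =>
    n * ∑ i ∈ Finset.range n, ENNReal.ofReal ((T (g n (i + 1)) ω - T (g n i) ω) ^ 2)
  have hmeas_sq : ∀ x y, Measurable fun ω => ENNReal.ofReal ((T x ω - T y ω) ^ 2) := fun x y =>
    (((hmeas x).sub (hmeas y)).pow_const 2).ennreal_ofReal
  have hWmeas : ∀ n, Measurable (W n) := fun n =>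
    (Finset.measurable_fun_sum _ fun i _ => hmeas_sq _ _).const_mul _
  have hWint : ∀ n, ∫⁻ ω, W n ω ∂ℙ ≤ ENNReal.ofReal (K * (b - a) ^ 2) := by
    intro n
    rcases Nat.eq_zero_or_pos n with rfl | hn
    · simp [W]
    rw [lintegral_const_mul _ (Finset.measurable_fun_sum _ fun i _ => hmeas_sq _ _),
      lintegral_finsetSum _ fun i _ => hmeas_sq _ _]
    calc (n : ENNReal) * ∑ i ∈ Finset.range n,
          ∫⁻ ω, ENNReal.ofReal ((T (g n (i + 1)) ω - T (g n i) ω) ^ 2) ∂ℙ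
        ≤ n * ∑ i ∈ Finset.range n, ENNReal.ofReal (K * ((b - a) / n) ^ 2) := by
          gcongr with i hi
          have hi' := Finset.mem_range.1 hi
          rw [← uniformGrid_succ_sub a b n i]
          exact hincr _ (uniformGrid_mem_Icc hab hi') _ (uniformGrid_mem_Icc hab hi'.le)
      _ = ENNReal.ofReal (K * (b - a) ^ 2) := by
          rw [Finset.sum_const, Finset.card_range, nsmul_eq_mul, ← ENNReal.ofReal_natCast n,
            ← ENNReal.ofReal_mul n.cast_nonneg, ← ENNReal.ofReal_mul n.cast_nonneg]
          congr 1
          field_simp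
  have hsup : ∀ᵐ ω ∂ℙ, ⨆ x ∈ Set.Icc a b, ENNReal.ofReal ((T x ω) ^ 2) ≤
      liminf (fun n => W n ω) atTop := by
    filter_upwards [hcont, hTa] with ω hω hω₀
    refine iSup₂_le fun x hx => ?_
    obtain ⟨k, hk, hlim⟩ := exists_tendsto_uniformGrid hx
    have hT : Tendsto (fun n => T (g n (k n)) ω) atTop (𝓝 (T x ω)) :=
      (hω x hx).tendsto.comp (tendsto_nhdsWithin_iff.2
        ⟨hlim, Eventually.of_forall fun n => uniformGrid_mem_Icc hab (hk n)⟩)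
    rw [← (ENNReal.tendsto_ofReal (hT.pow 2)).liminf_eq]
    refine liminf_le_liminf (Eventually.of_forall fun n => ?_)
    have h := sq_le_mul_sum_sq_increments (fun i => T (g n i) ω)
      (by simpa [g, uniformGrid_zero] using hω₀) (hk n)
    calc ENNReal.ofReal (T (g n (k n)) ω ^ 2)
        ≤ ENNReal.ofReal (n * ∑ i ∈ Finset.range n, (T (g n (i + 1)) ω - T (g n i) ω) ^ 2) :=
          ENNReal.ofReal_le_ofReal h
      _ = W n ω := by
          rw [ENNReal.ofReal_mul n.cast_nonneg, ENNReal.ofReal_natCast,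
            ENNReal.ofReal_sum_of_nonneg fun i _ => sq_nonneg _]
  calc ∫⁻ ω, ⨆ x ∈ Set.Icc a b, ENNReal.ofReal ((T x ω) ^ 2) ∂ℙ
      ≤ ∫⁻ ω, liminf (fun n => W n ω) atTop ∂ℙ := lintegral_mono_ae hsup
    _ ≤ liminf (fun n => ∫⁻ ω, W n ω ∂ℙ) atTop := lintegral_liminf_le hWmeas
    _ ≤ ENNReal.ofReal (K * (b - a) ^ 2) :=
        (liminf_le_liminf (Eventually.of_forall hWint)).trans_eq (liminf_const _)
    _ ≤ ENNReal.ofReal (4 * K * (b - a) ^ 2) :=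
        ENNReal.ofReal_le_ofReal (by nlinarith [mul_nonneg hK.le (sq_nonneg (b - a))])
end

section
/- Fix δ ∈ (0,1/2) and an integer r ≥ 1. There exists a constant ξ > 0 such that for all sufficiently large n, all i ∈ {1,…,r}, and all x ∈ V, one has |x|^{n-i} ≤ ξ · n^{-δ/2} · √(Σ_{t=0}^{n-r-1} x^{2t}). -/
open Filter Real Topology

/-- For `0 ≤ y ≤ 1` each of the `m` terms of the geometric sum dominates `y ^ (2 * k)`, `k ≥ m`. -/
lemma card_mul_pow_le_geom_sum {y : ℝ} (h0 : 0 ≤ y) (h1 : y ≤ 1) {m k : ℕ} (hmk : m ≤ k) :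
    (m : ℝ) * y ^ (2 * k) ≤ ∑ t ∈ Finset.range m, y ^ (2 * t) := by
  rw [← nsmul_eq_mul]
  simpa using Finset.card_nsmul_le_sum (Finset.range m) (fun t => y ^ (2 * t)) (y ^ (2 * k))
    fun t ht => pow_le_pow_of_le_one h0 h1 (by have := Finset.mem_range.1 ht; omega)

/-- For `1 + b ≤ y` with `1 ≤ 2 * m * b`, the geometric sum is at least half of
`y ^ (2 * m) / (y ^ 2 - 1)`. -/
lemma pow_le_two_mul_sq_sub_one_mul_geom_sum {y b : ℝ} (hb : 0 ≤ b) (hy : 1 + b ≤ y) {m : ℕ}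
    (hm : 1 ≤ 2 * m * b) :
    y ^ (2 * m) ≤ 2 * (y ^ 2 - 1) * ∑ t ∈ Finset.range m, y ^ (2 * t) := by
  have hg : (∑ t ∈ Finset.range m, y ^ (2 * t)) * (y ^ 2 - 1) = y ^ (2 * m) - 1 := by
    simp only [pow_mul]
    exact geom_sum_mul (y ^ 2) m
  have hbern : 1 + ((2 * m : ℕ) : ℝ) * b ≤ (1 + b) ^ (2 * m) :=
    one_add_mul_le_pow (by linarith) _
  have hmono : (1 + b) ^ (2 * m) ≤ y ^ (2 * m) := pow_le_pow_left₀ (by linarith) hy _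
  push_cast at hbern
  linarith

/-- The bound near `1` from above, at the inverse of a point `u ∈ [1 - a, 1 - b]`. -/
lemma inv_pow_le_geom_sum {u a b : ℝ} (hb : 0 ≤ b) (ha : a ≤ 1 / 2) (hua : 1 - a ≤ u)
    (hub : u ≤ 1 - b) {m k r : ℕ} (hm : 1 ≤ 2 * m * b) (hk : k ≤ m + r) :
    u⁻¹ ^ (2 * k) ≤ 16 * 4 ^ r * a * ∑ t ∈ Finset.range m, u⁻¹ ^ (2 * t) := by
  have hu : 0 < u := by linarith
  set y := u⁻¹ with hy
  have hyu : y * u = 1 := inv_mul_cancel₀ hu.ne'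
  have hy1 : 1 ≤ y := (one_le_inv₀ hu).2 (by linarith)
  have hy2 : y ≤ 2 := by nlinarith
  have hyb : 1 + b ≤ y := by nlinarith
  have hsq : y ^ 2 - 1 ≤ 8 * a := by nlinarith
  set S := ∑ t ∈ Finset.range m, y ^ (2 * t)
  have hS : 0 ≤ S := Finset.sum_nonneg fun t _ => by positivity
  have hgeom : y ^ (2 * m) ≤ 2 * (y ^ 2 - 1) * S :=
    pow_le_two_mul_sq_sub_one_mul_geom_sum hb hyb hm
  have hr : y ^ (2 * r) ≤ 4 ^ r := by
    rw [pow_mul]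
    exact pow_le_pow_left₀ (by positivity) (by nlinarith) r
  calc y ^ (2 * k) ≤ y ^ (2 * r + 2 * m) := pow_le_pow_right₀ hy1 (by omega)
    _ = y ^ (2 * r) * y ^ (2 * m) := pow_add _ _ _
    _ ≤ 4 ^ r * (2 * (8 * a) * S) := by
        gcongr
        exact hgeom.trans (by gcongr)
    _ = 16 * 4 ^ r * a * S := by ring

lemma abs_mem_of_mem_Vset {δ : ℝ} {n : ℕ} {x : ℝ} (hx : x ∈ Vset δ n)
    (hI : ∀ u ∈ I1 δ n, 0 ≤ u) : |x| ∈ I1 δ n ∨ ∃ u ∈ I1 δ n, u⁻¹ = |x| := by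
  rcases hx with ((hx | ⟨u, hu, rfl⟩) | ⟨u, hu, hux⟩) | hx
  · exact Or.inl (by rwa [abs_of_nonneg (hI x hx)])
  · exact Or.inr ⟨u, hu, (abs_of_nonneg (inv_nonneg.2 (hI u hu))).symm⟩
  · exact Or.inr ⟨u, hu, by rw [← abs_neg x, ← hux, abs_of_nonneg (inv_nonneg.2 (hI u hu))]⟩
  · exact Or.inl (by rwa [← abs_neg x, abs_of_nonneg (hI (-x) hx)])

/-- For fixed `δ ∈ (0,1/2)` and `r ≥ 1`, there is `ξ > 0` such that for
all sufficiently large `n`, all `1 ≤ i ≤ r` and all `x ∈ V`,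
`|x|^(n-i) ≤ ξ·n^(-δ/2)·√(∑_{t<n-r} x^(2t))`. -/
theorem power_bounded_by_sigma_on_V
    (δ : ℝ) (hδ : δ ∈ Set.Ioo (0 : ℝ) (1 / 2))
    (r : ℕ) (hr : 1 ≤ r) :
    ∃ ξ : ℝ, 0 < ξ ∧ ∀ᶠ n : ℕ in atTop, ∀ i : ℕ, 1 ≤ i → i ≤ r →
      ∀ x ∈ Vset δ n,
        |x| ^ (n - i) ≤
          ξ * (n : ℝ) ^ (-(δ / 2)) *
            Real.sqrt (∑ t ∈ Finset.range (n - r), x ^ (2 * t)) := by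
  obtain ⟨h0, h1⟩ := hδ
  refine ⟨4 * 2 ^ r, by positivity, ?_⟩
  have hlim : Tendsto (fun n : ℕ => (n : ℝ) ^ (-δ)) atTop (𝓝 0) :=
    (tendsto_rpow_neg_atTop h0).comp tendsto_natCast_atTop_atTop
  filter_upwards [hlim.eventually_le_const (show (0 : ℝ) < 1 / 2 by norm_num),
    eventually_ge_atTop (2 * r)] with n ha hn i hi hir x hx
  have hn1 : (1 : ℝ) ≤ n := by exact_mod_cast (show 1 ≤ n by omega)
  have hn0 : (0 : ℝ) < n := by linarith
  have hm : (n : ℝ) ≤ 2 * (n - r : ℕ) := by exact_mod_cast (show n ≤ 2 * (n - r) by omega)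
  have hb : 0 ≤ (n : ℝ) ^ (-(1 - δ)) := by positivity
  have hnb : 1 ≤ (n : ℝ) * (n : ℝ) ^ (-(1 - δ)) := by
    rw [← rpow_one_add' hn0.le (by linarith)]
    exact one_le_rpow hn1 (by linarith)
  have hna : 1 ≤ (n : ℝ) * (n : ℝ) ^ (-δ) := by
    rw [← rpow_one_add' hn0.le (by linarith)]
    exact one_le_rpow hn1 (by linarith)
  have hsum : ∑ t ∈ Finset.range (n - r), x ^ (2 * t) =
      ∑ t ∈ Finset.range (n - r), |x| ^ (2 * t) := by simp only [pow_mul, sq_abs]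
  have key : |x| ^ (2 * (n - i)) ≤ 16 * 4 ^ r * (n : ℝ) ^ (-δ) *
      ∑ t ∈ Finset.range (n - r), |x| ^ (2 * t) := by
    rcases abs_mem_of_mem_Vset hx fun u hu => by linarith [hu.1] with hx | ⟨u, hu, hux⟩
    · have hle := card_mul_pow_le_geom_sum (abs_nonneg x) (by linarith [hx.2])
        (show n - r ≤ n - i by omega)
      set a := (n : ℝ) ^ (-δ)
      have ha0 : 0 ≤ a := by positivity
      have hma : 1 ≤ 2 * a * (n - r : ℕ) := by nlinarith
      have h4 : (1 : ℝ) ≤ 4 ^ r := one_le_pow₀ (by norm_num)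
      calc |x| ^ (2 * (n - i)) ≤ 2 * a * (n - r : ℕ) * |x| ^ (2 * (n - i)) :=
            le_mul_of_one_le_left (by positivity) hma
        _ = 2 * a * ((n - r : ℕ) * |x| ^ (2 * (n - i))) := by ring
        _ ≤ 16 * 4 ^ r * a * ∑ t ∈ Finset.range (n - r), |x| ^ (2 * t) := by
            gcongr
            linarith
    · rw [← hux]
      exact inv_pow_le_geom_sum hb ha hu.1 hu.2 (hnb.trans (by gcongr)) (by omega)
  rw [hsum]
  refine le_of_abs_le (abs_le_of_sq_le_sq ?_ (by positivity))
  have ha2 : ((n : ℝ) ^ (-(δ / 2))) ^ 2 = (n : ℝ) ^ (-δ) := by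
    rw [← rpow_mul_natCast hn0.le]
    congr 1
    push_cast
    ring
  rw [mul_pow, mul_pow, mul_pow, ha2, sq_sqrt (Finset.sum_nonneg fun t _ => by positivity),
    ← pow_mul, ← pow_mul, mul_comm (n - i), mul_comm r, pow_mul 2]
  norm_num
  simpa using key
end
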